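/- Let Ω be homogeneous of degree zero with ‖Ω‖_{L^∞(S^{d−1})} ≤ 1 and let b ∈ BMO(ℝ^d) with ‖b‖_{BMO} ≤ 1. Let p ∈ (1,∞), let s ≥ 100 be an integer, j ∈ ℤ, ν ∈ Λ_s, x ∈ ℝ^d, and let R be the cube centered at x with side length 2^{j+5}d. Then ‖Σ_{i≤j} Σ_{I∈S_{i−s}, I∩(x+R_{jν}^s)≠∅} |(b − ⟨b⟩_I) T_{iν}^s h_I| ‖_{L^p(log L)^{−p}, R} ≤ C_{d,γ,p} s. -/

import Mathlib

open MeasureTheory Metric Set Filter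
open scoped ENNReal NNReal Real Topology Pointwise FourierTransform RealInnerProductSpace

noncomputable section

/-- Euclidean space `ℝ^d`. -/
abbrev Rd (d : ℕ) := EuclideanSpace ℝ (Fin d)

/-- Surface measure on the unit sphere `S^{d-1}`, realized as the `(d-1)`-dimensional
Hausdorff measure restricted to the sphere. -/
def sphereMeasure (d : ℕ) : Measure (Rd d) := (μH[(d : ℝ) - 1]).restrict (sphere (0 : Rd d) 1)

/-- `Φ(t) = t log(e + t)`. -/
def Phi (t : ℝ) : ℝ := t * Real.log (Real.exp 1 + t)

/-- `Q` is an (axis-parallel, closed) cube with side length `l`. -/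
def IsCubeSide {d : ℕ} (Q : Set (Rd d)) (l : ℝ) : Prop :=
  ∃ c : Rd d, Q = {x | ∀ i, x i ∈ Icc (c i) (c i + l)}

/-- `Q` is a (nondegenerate) cube. -/
def IsCube {d : ℕ} (Q : Set (Rd d)) : Prop := ∃ l : ℝ, 0 < l ∧ IsCubeSide Q l

/-- `Q` is a standard dyadic cube `2^k([0,1]^d + m)`. -/
def IsDyadicCube {d : ℕ} (Q : Set (Rd d)) : Prop :=
  ∃ (k : ℤ) (m : Fin d → ℤ),
    Q = {x | ∀ i, x i ∈ Icc ((2:ℝ)^k * m i) ((2:ℝ)^k * (m i + 1))}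

/-- mean value `⟨b⟩_Q` of `b` on `Q`. -/
def cavg {d : ℕ} (b : Rd d → ℝ) (Q : Set (Rd d)) : ℝ := ⨍ x in Q, b x

/-- `b` is in `BMO(ℝ^d)` with `‖b‖_{BMO} ≤ M`. -/
def BMOBound {d : ℕ} (b : Rd d → ℝ) (M : ℝ) : Prop :=
  MeasureTheory.LocallyIntegrable b volume ∧
    ∀ Q : Set (Rd d), IsCube Q → (⨍ x in Q, |b x - cavg b Q|) ≤ M

/-- `Ω` is homogeneous of degree zero. -/
def Homog0 {d : ℕ} (Ω : Rd d → ℝ) : Prop := ∀ r : ℝ, 0 < r → ∀ x : Rd d, Ω (r • x) = Ω x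

/-- The Luxemburg norm `‖f‖_{L^p(log L)^α, Q}`
(`∞`, i.e. `⊤`, if no admissible constant exists). -/
def LuxNorm {d : ℕ} (p α : ℝ) (Q : Set (Rd d)) (f : Rd d → ℝ) : ℝ≥0∞ :=
  sInf {c : ℝ≥0∞ | ∃ t : ℝ, 0 < t ∧ c = ENNReal.ofReal t ∧
    ∫⁻ x in Q,
      ENNReal.ofReal ((|f x| / t) ^ p * (Real.log (Real.exp 1 + |f x| / t)) ^ α) ≤ volume Q}

/-- convolution `K * g`. -/
def convK {d : ℕ} (K g : Rd d → ℝ) (x : Rd d) : ℝ := ∫ y, K (x - y) * g y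

/-- Truncated kernel `K_j(x) = Ω(x/|x|)|x|^{-d} φ_j(x)`, where `φ_j(x) = φ(2^{-j}x)`. -/
def Kj {d : ℕ} (Ωi φ : Rd d → ℝ) (j : ℤ) (x : Rd d) : ℝ :=
  Ωi (‖x‖⁻¹ • x) / ‖x‖ ^ d * φ ((2:ℝ) ^ (-j) • x)

/-- Hypotheses on the radial cut-off function `φ`: smooth, nonnegative, radial,
supported in `{1/2 ≤ |x| ≤ 2}`, with `Σ_j φ(2^{-j}x) = 1` for `x ≠ 0`. -/
def PhiCutoff {d : ℕ} (φ : Rd d → ℝ) : Prop :=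
  ContDiff ℝ (⊤ : ℕ∞) φ ∧ (∀ x, 0 ≤ φ x) ∧ (∃ g : ℝ → ℝ, ∀ x, φ x = g ‖x‖) ∧
    Function.support φ ⊆ {x : Rd d | 1/2 ≤ ‖x‖ ∧ ‖x‖ ≤ 2} ∧
    ∀ x : Rd d, x ≠ 0 → HasSum (fun j : ℤ => φ ((2:ℝ) ^ (-j) • x)) 1

/-- The angular cut-offs `Γ_ν^s` built from `ζ` and the net `{e_ν}`; here `a = sγ`. -/
def Gam {d : ℕ} {ι : Type} [Fintype ι] (ζ : Rd d → ℝ) (e : ι → Rd d) (a : ℝ)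
    (ν : ι) (ξ : Rd d) : ℝ :=
  ζ ((2:ℝ) ^ a • (‖ξ‖⁻¹ • ξ - e ν)) / ∑ ν' : ι, ζ ((2:ℝ) ^ a • (‖ξ‖⁻¹ • ξ - e ν'))

/-- Symbol of the multiplier operator `G_ν^s`: `ψ(2^{sγ}⟨ξ/|ξ|, e_ν⟩)`; here `a = sγ`. -/
def GSymb {d : ℕ} (ψ : ℝ → ℝ) (a : ℝ) (e : Rd d) (ξ : Rd d) : ℝ :=
  ψ ((2:ℝ) ^ a * ⟪‖ξ‖⁻¹ • ξ, e⟫)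

/-- Kernel `K_{jν}^s(x) = Ω(x/|x|)|x|^{-d} φ_j(x) Γ_ν^s(x/|x|)`; here `a = sγ`. -/
def Kjnu {d : ℕ} {ι : Type} [Fintype ι] (Ω φ ζ : Rd d → ℝ) (e : ι → Rd d) (a : ℝ)
    (j : ℤ) (ν : ι) (x : Rd d) : ℝ :=
  Ω (‖x‖⁻¹ • x) / ‖x‖ ^ d * φ ((2:ℝ) ^ (-j) • x) * Gam ζ e a ν (‖x‖⁻¹ • x)

/-- Hypotheses on `ζ`: smooth, nonnegative, radial, supported in `B(0,1)`, `≡1` on `B(0,1/2)`. -/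
def ZetaCutoff {d : ℕ} (ζ : Rd d → ℝ) : Prop :=
  ContDiff ℝ (⊤ : ℕ∞) ζ ∧ (∀ x, 0 ≤ ζ x) ∧ (∃ g : ℝ → ℝ, ∀ x, ζ x = g ‖x‖) ∧
    Function.support ζ ⊆ ball (0 : Rd d) 1 ∧ ∀ x ∈ ball (0 : Rd d) (1/2), ζ x = 1

/-- Hypotheses on `ψ`: smooth, `0 ≤ ψ ≤ 1`, supported in `[-4,4]`, `≡1` on `[-2,2]`. -/
def PsiCutoff (ψ : ℝ → ℝ) : Prop :=
  ContDiff ℝ (⊤ : ℕ∞) ψ ∧ (∀ t, 0 ≤ ψ t ∧ ψ t ≤ 1) ∧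
    Function.support ψ ⊆ Icc (-4:ℝ) 4 ∧ ∀ t ∈ Icc (-2:ℝ) 2, ψ t = 1

/-- `{e_ν}_{ν∈Λ_s}` is a `2^{-sγ-4}`-separated net of unit vectors covering the sphere. -/
def SphereNet {d : ℕ} {ι : Type} (e : ι → Rd d) (s : ℕ) (γ : ℝ) : Prop :=
  (∀ ν, ‖e ν‖ = 1) ∧
    (∀ ν ν', ν ≠ ν' → (2:ℝ) ^ (-(s:ℝ) * γ - 4) < ‖e ν - e ν'‖) ∧
    ∀ θ : Rd d, ‖θ‖ = 1 → ∃ ν, ‖θ - e ν‖ ≤ (2:ℝ) ^ (-(s:ℝ) * γ - 4)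

/-- `G ν` is the Fourier multiplier operator with symbol `ψ(2^{sγ}⟨ξ/|ξ|, e_ν⟩)`;
here `a = sγ`. -/
def IsGNu {d : ℕ} {ι : Type} (G : ι → (Rd d → ℂ) → (Rd d → ℂ)) (ψ : ℝ → ℝ) (a : ℝ)
    (e : ι → Rd d) : Prop :=
  ∀ (ν : ι) (g : Rd d → ℂ), Integrable g volume →
    ∀ ξ, 𝓕 (G ν g) ξ = (GSymb ψ a (e ν) ξ : ℂ) * 𝓕 g ξ

/-- `S` is a collection of dyadic cubes with pairwise disjoint interiors and, for every
`Q ∈ S`, `h Q` is integrable, supported in `Q`, with `‖h Q‖_{L¹} ≤ |Q|`. -/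
def GoodFamily {d : ℕ} (S : Set (Set (Rd d))) (h : Set (Rd d) → Rd d → ℝ) : Prop :=
  (∀ Q ∈ S, IsDyadicCube Q) ∧
    (S.Pairwise fun Q Q' => interior Q ∩ interior Q' = ∅) ∧
    ∀ Q ∈ S, Integrable (h Q) volume ∧ Function.support (h Q) ⊆ Q ∧
      (∫⁻ x, ENNReal.ofReal |h Q x|) ≤ volume Q

/-- The tube `R̃_{jν}^s` around `e_ν`; here `a = sγ`. -/
def Rtil {d : ℕ} (eν : Rd d) (j : ℤ) (a : ℝ) : Set (Rd d) :=
  {y | |⟪y, eν⟫| ≤ (2:ℝ) ^ (j + 2) ∧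
    ‖y - ⟪y, eν⟫ • eν‖ ≤ (2:ℝ) ^ (j + 2) * (2:ℝ) ^ (-a)}

/-- `R_{jν}^s = R̃_{jν}^s + R̃_{jν}^s`. -/
def RR {d : ℕ} (eν : Rd d) (j : ℤ) (a : ℝ) : Set (Rd d) := Rtil eν j a + Rtil eν j a

theorem ENNReal.add_pow_succ_le (y a : ℝ≥0∞) (n : ℕ) :
    (y + a) ^ (n + 1) ≤ y ^ (n + 1) + (n + 1) * (a * (y + a) ^ n) := by
  induction n with
  | zero => simp
  | succ n ih =>
    calc (y + a) ^ (n + 2) = y * (y + a) ^ (n + 1) + a * (y + a) ^ (n + 1) := by ring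
      _ ≤ y * (y ^ (n + 1) + (n + 1) * (a * (y + a) ^ n)) + a * (y + a) ^ (n + 1) := by gcongr
      _ = y ^ (n + 2) + (n + 1) * (a * (y * (y + a) ^ n)) + a * (y + a) ^ (n + 1) := by ring
      _ ≤ y ^ (n + 2) + (n + 1) * (a * ((y + a) * (y + a) ^ n)) + a * (y + a) ^ (n + 1) := by
          gcongr; exact le_self_add
      _ = _ := by push_cast; ring

theorem ENNReal.sum_pow_succ_le {ι : Type*} (s : Finset ι) (k : ι → ℤ) (a : ι → ℝ≥0∞) (n : ℕ) :
    (∑ I ∈ s, a I) ^ (n + 1) ≤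
      (n + 1) * ∑ I ∈ s, a I * (∑ J ∈ s with k I ≤ k J, a J) ^ n := by
  classical
  induction s using Finset.induction_on_min_value k with
  | empty => simp
  | insert I s hI hmin ih =>
    rw [Finset.sum_insert hI, Finset.sum_insert hI, add_comm (a I)]
    refine (ENNReal.add_pow_succ_le _ _ _).trans ?_
    have h1 : (insert I s).filter (fun J => k I ≤ k J) = insert I s := by
      apply Finset.filter_true_of_mem
      intro J hJ
      rcases Finset.mem_insert.1 hJ with rfl | hJ
      · exact le_rfl
      · exact hmin J hJ
    rw [h1, Finset.sum_insert hI, add_comm (a I) (∑ J ∈ s, a J), mul_add, add_comm]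
    gcongr
    refine ih.trans ?_
    gcongr
    exact Finset.subset_insert _ s

/-- The dual form of the maximal inequality for a nested family of sets `Q I`, each carrying a
proportional piece `E I`, the pieces being disjoint. -/
theorem lintegral_sum_indicator_pow_le {X ι : Type*} [MeasurableSpace X] (μ : Measure X)
    (s : Finset ι) (k : ι → ℤ) (Q E : ι → Set X) (κ : ℝ≥0∞) (c : ι → ℝ≥0∞) (n : ℕ)
    (hQ : ∀ I, MeasurableSet (Q I)) (hE : ∀ I, MeasurableSet (E I)) (hEQ : ∀ I, E I ⊆ Q I)
    (hdisj : (s : Set ι).PairwiseDisjoint E)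
    (hnest : ∀ I ∈ s, ∀ J ∈ s, k I ≤ k J → (Q I ∩ Q J).Nonempty → Q I ⊆ Q J)
    (hκ0 : κ ≠ 0) (hκ : κ ≠ ⊤) (hvol : ∀ I, μ (Q I) ≤ κ * μ (E I))
    (hfin : ∀ I, μ (Q I) ≠ ⊤) (hc : ∀ I, c I ≠ ⊤) :
    ∫⁻ z, (∑ I ∈ s, (Q I).indicator (fun _ => κ⁻¹ * c I) z) ^ (n + 1) ∂μ ≤
      2 * (2 * (n + 1)) ^ (n + 1) * ∑ I ∈ s, c I ^ (n + 1) * μ (E I) := by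
  classical
  set H : X → ℝ≥0∞ := fun z => ∑ I ∈ s, (Q I).indicator (fun _ => κ⁻¹ * c I) z with hH
  have hHm : Measurable H :=
    Finset.measurable_fun_sum s fun I _ => measurable_const.indicator (hQ I)
  have hHb : ∀ z, H z ≤ ∑ I ∈ s, κ⁻¹ * c I := fun z =>
    Finset.sum_le_sum fun I _ => indicator_le_self' (fun _ _ => zero_le) z
  have hfinH : ∫⁻ z, H z ^ (n + 1) ∂μ ≠ ⊤ := by
    have h1 : ∀ z, H z ^ (n + 1) ≤
        (⋃ I ∈ s, Q I).indicator (fun _ => (∑ I ∈ s, κ⁻¹ * c I) ^ (n + 1)) z := by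
      intro z
      by_cases hz : z ∈ ⋃ I ∈ s, Q I
      · rw [indicator_of_mem hz]
        gcongr
        exact hHb z
      · rw [indicator_of_notMem hz]
        have : H z = 0 := by
          refine Finset.sum_eq_zero fun I hI => indicator_of_notMem ?_ _
          exact fun h => hz (mem_biUnion hI h)
        simp [this]
    refine ne_top_of_le_ne_top ?_ (lintegral_mono h1)
    rw [lintegral_indicator (Finset.measurableSet_biUnion s fun I _ => hQ I), setLIntegral_const]
    refine ENNReal.mul_ne_top (ENNReal.pow_ne_top (ENNReal.sum_ne_top.2 fun I _ => ?_)) ?_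
    · exact ENNReal.mul_ne_top (ENNReal.inv_ne_top.2 hκ0) (hc I)
    · exact ((measure_biUnion_finset_le s Q).trans_lt (ENNReal.sum_lt_top.2
        fun I _ => (hfin I).lt_top)).ne
  have hterm : ∀ I ∈ s, ∫⁻ z, (Q I).indicator (fun _ => κ⁻¹ * c I) z *
      (∑ J ∈ s with k I ≤ k J, (Q J).indicator (fun _ => κ⁻¹ * c J) z) ^ n ∂μ ≤
      ∫⁻ z in E I, c I * H z ^ n ∂μ := by
    intro I hI
    rcases (E I).eq_empty_or_nonempty with he | ⟨w, hw⟩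
    · have : μ (Q I) = 0 := by simpa [he] using hvol I
      have h0 : ∀ z, (Q I).indicator (fun _ => κ⁻¹ * c I) z *
          (∑ J ∈ s with k I ≤ k J, (Q J).indicator (fun _ => κ⁻¹ * c J) z) ^ n =
          (Q I).indicator (fun z => κ⁻¹ * c I *
          (∑ J ∈ s with k I ≤ k J, (Q J).indicator (fun _ => κ⁻¹ * c J) z) ^ n) z := by
        intro z
        by_cases hz : z ∈ Q I <;> simp [hz]
      simp_rw [h0]
      rw [lintegral_indicator (hQ I), setLIntegral_measure_zero _ _ this]
      exact zero_le
    · set S : ℝ≥0∞ := ∑ J ∈ s with k I ≤ k J, (Q J).indicator (fun _ => κ⁻¹ * c J) w with hS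
      have hconst : ∀ z ∈ Q I,
          ∑ J ∈ s with k I ≤ k J, (Q J).indicator (fun _ => κ⁻¹ * c J) z = S := by
        intro z hz
        refine Finset.sum_congr rfl fun J hJ => ?_
        rw [Finset.mem_filter] at hJ
        have hiff : ∀ y ∈ Q I, (y ∈ Q J ↔ (Q I ∩ Q J).Nonempty) := fun y hy =>
          ⟨fun h => ⟨y, hy, h⟩, fun h => hnest I hI J hJ.1 hJ.2 h hy⟩
        have : z ∈ Q J ↔ w ∈ Q J := (hiff z hz).trans (hiff w (hEQ I hw)).symm
        by_cases hz' : z ∈ Q J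
        · rw [indicator_of_mem hz', indicator_of_mem (this.1 hz')]
        · rw [indicator_of_notMem hz', indicator_of_notMem (fun h => hz' (this.2 h))]
      have hSH : ∀ z ∈ E I, S ≤ H z := by
        intro z hz
        rw [← hconst z (hEQ I hz)]
        exact Finset.sum_le_sum_of_subset (Finset.filter_subset _ _)
      calc _ = ∫⁻ z in Q I, κ⁻¹ * c I * S ^ n ∂μ := by
            rw [← lintegral_indicator (hQ I)]
            refine lintegral_congr fun z => ?_
            by_cases hz : z ∈ Q I
            · simp only [indicator_of_mem hz, hconst z hz]
            · simp [hz]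
        _ = κ⁻¹ * c I * S ^ n * μ (Q I) := setLIntegral_const _ _
        _ ≤ κ⁻¹ * c I * S ^ n * (κ * μ (E I)) := by gcongr; exact hvol I
        _ = (κ⁻¹ * κ) * (c I * S ^ n * μ (E I)) := by ring
        _ = ∫⁻ z in E I, c I * S ^ n ∂μ := by
            rw [ENNReal.inv_mul_cancel hκ0 hκ, one_mul, setLIntegral_const]
        _ ≤ _ := by
            refine setLIntegral_mono' (hE I) fun z hz => ?_
            gcongr
            exact hSH z hz
  have hyoung : ∀ (x y : ℝ≥0∞), (n + 1) * (x * y ^ n) ≤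
      (2 * (n + 1)) ^ (n + 1) * x ^ (n + 1) + 2⁻¹ * y ^ (n + 1) := by
    intro x y
    rcases le_total (2 * (n + 1) * x) y with h | h
    · refine le_trans ?_ le_add_self
      calc (n + 1) * (x * y ^ n) = (2⁻¹ * 2) * ((n + 1) * (x * y ^ n)) := by
            rw [ENNReal.inv_mul_cancel (by simp) (by simp), one_mul]
        _ = 2⁻¹ * (2 * (n + 1) * x * y ^ n) := by ring
        _ ≤ 2⁻¹ * (y * y ^ n) := by gcongr
        _ = _ := by ring
    · refine le_trans ?_ le_self_add
      calc (n + 1) * (x * y ^ n) ≤ (2 * (n + 1)) * (x * (2 * (n + 1) * x) ^ n) := by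
            gcongr
            exact le_mul_of_one_le_left (zero_le) (by norm_num)
        _ = _ := by rw [mul_pow _ x, pow_succ (2 * ((n : ℝ≥0∞) + 1))]; ring
  have hmain : ∫⁻ z, H z ^ (n + 1) ∂μ ≤
      (2 * (n + 1)) ^ (n + 1) * ∑ I ∈ s, c I ^ (n + 1) * μ (E I) +
        2⁻¹ * ∫⁻ z, H z ^ (n + 1) ∂μ := by
    calc ∫⁻ z, H z ^ (n + 1) ∂μ
        ≤ ∫⁻ z, (n + 1) * ∑ I ∈ s, (Q I).indicator (fun _ => κ⁻¹ * c I) z *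
          (∑ J ∈ s with k I ≤ k J, (Q J).indicator (fun _ => κ⁻¹ * c J) z) ^ n ∂μ :=
          lintegral_mono fun z => ENNReal.sum_pow_succ_le s k _ n
      _ = (n + 1) * ∑ I ∈ s, ∫⁻ z, (Q I).indicator (fun _ => κ⁻¹ * c I) z *
          (∑ J ∈ s with k I ≤ k J, (Q J).indicator (fun _ => κ⁻¹ * c J) z) ^ n ∂μ := by
          have hm : ∀ I, Measurable fun z => (Q I).indicator (fun _ => κ⁻¹ * c I) z *
              (∑ J ∈ s with k I ≤ k J, (Q J).indicator (fun _ => κ⁻¹ * c J) z) ^ n := fun I =>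
            (measurable_const.indicator (hQ I)).mul ((Finset.measurable_fun_sum _
              fun J _ => measurable_const.indicator (hQ J)).pow_const n)
          rw [lintegral_const_mul _ (Finset.measurable_fun_sum _ fun I _ => hm I),
            lintegral_finsetSum _ fun I _ => hm I]
      _ ≤ (n + 1) * ∑ I ∈ s, ∫⁻ z in E I, c I * H z ^ n ∂μ := by
          exact mul_le_mul_right (Finset.sum_le_sum hterm) _
      _ = ∑ I ∈ s, ∫⁻ z in E I, (n + 1) * (c I * H z ^ n) ∂μ := by
          rw [Finset.mul_sum]
          refine Finset.sum_congr rfl fun I _ => ?_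
          rw [lintegral_const_mul _ ((hHm.pow_const n).const_mul _)]
      _ ≤ ∑ I ∈ s, ∫⁻ z in E I, ((2 * (n + 1)) ^ (n + 1) * c I ^ (n + 1) +
            2⁻¹ * H z ^ (n + 1)) ∂μ := by
          exact Finset.sum_le_sum fun I _ => lintegral_mono fun z => hyoung _ _
      _ = (2 * (n + 1)) ^ (n + 1) * ∑ I ∈ s, c I ^ (n + 1) * μ (E I) +
            2⁻¹ * ∑ I ∈ s, ∫⁻ z in E I, H z ^ (n + 1) ∂μ := by
          rw [Finset.mul_sum, Finset.mul_sum, ← Finset.sum_add_distrib]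
          refine Finset.sum_congr rfl fun I _ => ?_
          rw [lintegral_add_left measurable_const, setLIntegral_const,
            lintegral_const_mul _ (hHm.pow_const _), mul_assoc]
      _ ≤ _ := by
          gcongr
          rw [← lintegral_biUnion_finset hdisj fun I _ => hE I]
          exact setLIntegral_le_lintegral _ _
  set A := ∫⁻ z, H z ^ (n + 1) ∂μ
  have h2 : 2⁻¹ * A ≠ ⊤ := ENNReal.mul_ne_top (by simp) hfinH
  have hA : 2⁻¹ * A + 2⁻¹ * A = A := by rw [← add_mul, ENNReal.inv_two_add_inv_two, one_mul]
  have h3 : 2⁻¹ * A ≤ (2 * (n + 1)) ^ (n + 1) * ∑ I ∈ s, c I ^ (n + 1) * μ (E I) := by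
    rw [← ENNReal.add_le_add_iff_right h2, hA]
    exact hmain
  calc A = 2 * (2⁻¹ * A) := by
        rw [← mul_assoc, ENNReal.mul_inv_cancel (by simp) (by simp), one_mul]
    _ ≤ 2 * ((2 * (n + 1)) ^ (n + 1) * ∑ I ∈ s, c I ^ (n + 1) * μ (E I)) := by gcongr
    _ = _ := by ring

/-- The index of the cell of side `2^k` of the dyadic grid with origin `τ` that contains `z`. -/
def gridIndex {d : ℕ} (τ : Fin d → ℝ) (k : ℤ) (z : Fin d → ℝ) : Fin d → ℤ :=
  fun i => ⌊(z i - τ i) / (2:ℝ) ^ k⌋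

/-- The half-open cell of side `2^k` and index `m` of the dyadic grid with origin `τ`. -/
def gridCell {d : ℕ} (τ : Fin d → ℝ) (k : ℤ) (m : Fin d → ℤ) : Set (Fin d → ℝ) :=
  {z | gridIndex τ k z = m}

/-- The indices of the cells of side `2^k` contained in the cell of side `2^(k+1)` and index `m`. -/
def gridChildren {d : ℕ} (m : Fin d → ℤ) : Finset (Fin d → ℤ) :=
  Fintype.piFinset fun i => {2 * m i, 2 * m i + 1}

theorem gridCell_eq_pi {d : ℕ} (τ : Fin d → ℝ) (k : ℤ) (m : Fin d → ℤ) :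
    gridCell τ k m = univ.pi fun i => Ico (τ i + 2 ^ k * m i) (τ i + 2 ^ k * (m i + 1)) := by
  ext z
  have h2 : (0:ℝ) < 2 ^ k := by positivity
  simp only [gridCell, gridIndex, mem_ofPred_eq, funext_iff, mem_univ_pi, mem_Ico, Int.floor_eq_iff]
  refine forall_congr' fun i => and_congr ?_ ?_
  · rw [le_div_iff₀ h2]; constructor <;> intro h <;> linarith
  · rw [div_lt_iff₀ h2]; constructor <;> intro h <;> linarith

theorem measurableSet_gridCell {d : ℕ} (τ : Fin d → ℝ) (k : ℤ) (m : Fin d → ℤ) :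
    MeasurableSet (gridCell τ k m) := by
  rw [gridCell_eq_pi]
  exact MeasurableSet.univ_pi fun i => measurableSet_Ico

theorem volume_gridCell {d : ℕ} (τ : Fin d → ℝ) (k : ℤ) (m : Fin d → ℤ) :
    volume (gridCell τ k m) = ENNReal.ofReal (2 ^ k) ^ d := by
  rw [gridCell_eq_pi, Real.volume_pi_Ico]
  have : ∀ i, τ i + 2 ^ k * ((m i : ℝ) + 1) - (τ i + 2 ^ k * m i) = 2 ^ k := fun i => by ring
  simp [this]

theorem volume_gridCell_ne_zero {d : ℕ} (τ : Fin d → ℝ) (k : ℤ) (m : Fin d → ℤ) :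
    volume (gridCell τ k m) ≠ 0 := by
  rw [volume_gridCell]
  exact pow_ne_zero _ (by simp; positivity)

theorem volume_gridCell_ne_top {d : ℕ} (τ : Fin d → ℝ) (k : ℤ) (m : Fin d → ℤ) :
    volume (gridCell τ k m) ≠ ⊤ := by
  rw [volume_gridCell]
  finiteness

theorem gridCell_ae_eq_Icc {d : ℕ} (τ : Fin d → ℝ) (k : ℤ) (m : Fin d → ℤ) :
    gridCell τ k m =ᵐ[volume]
      Icc (fun i => τ i + 2 ^ k * (m i : ℝ)) (fun i => τ i + 2 ^ k * (m i : ℝ) + 2 ^ k) := by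
  rw [gridCell_eq_pi]
  have : (fun i => τ i + 2 ^ k * (m i : ℝ) + (2:ℝ) ^ k) =
      fun i => τ i + 2 ^ k * ((m i : ℝ) + 1) := by ext i; ring
  rw [this]
  exact Measure.univ_pi_Ico_ae_eq_Icc

theorem Icc_eq_closedBall_pi {d : ℕ} (a : Fin d → ℝ) {l : ℝ} (hl : 0 ≤ l) :
    Icc a (fun i => a i + l) = closedBall (fun i => a i + l / 2) (l / 2) := by
  ext z
  simp only [closedBall_pi _ (by positivity : 0 ≤ l / 2), Real.closedBall_eq_Icc, mem_univ_pi, mem_Icc,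
    Pi.le_def, ← forall_and]
  refine forall_congr' fun i => and_congr ?_ ?_ <;> constructor <;> intro h <;> linarith

theorem gridIndex_succ {d : ℕ} (τ : Fin d → ℝ) (k : ℤ) (z : Fin d → ℝ) (i : Fin d) :
    gridIndex τ (k + 1) z i = gridIndex τ k z i / 2 := by
  have : (z i - τ i) / (2:ℝ) ^ (k + 1) = (z i - τ i) / (2:ℝ) ^ k / (2 : ℕ) := by
    rw [zpow_add₀ (by norm_num), zpow_one, div_div]; norm_num
  simp only [gridIndex, this, Int.floor_div_natCast]
  norm_num

theorem gridIndex_congr {d : ℕ} {τ : Fin d → ℝ} {k k' : ℤ} (hk : k ≤ k') {z w : Fin d → ℝ}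
    (h : gridIndex τ k z = gridIndex τ k w) : gridIndex τ k' z = gridIndex τ k' w := by
  induction k', hk using Int.leInduction with
  | base => exact h
  | succ k' _ ih => ext i; rw [gridIndex_succ, gridIndex_succ, ih]

theorem gridCell_subset_of_nonempty {d : ℕ} {τ : Fin d → ℝ} {k k' : ℤ} (hk : k ≤ k')
    {m m' : Fin d → ℤ} (h : (gridCell τ k m ∩ gridCell τ k' m').Nonempty) :
    gridCell τ k m ⊆ gridCell τ k' m' := by
  obtain ⟨w, hw, hw'⟩ := h
  intro z hz
  exact (gridIndex_congr hk (Eq.trans hz (Eq.symm hw))).trans hw'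

theorem gridCell_succ {d : ℕ} (τ : Fin d → ℝ) (k : ℤ) (m : Fin d → ℤ) :
    gridCell τ (k + 1) m = ⋃ m' ∈ gridChildren m, gridCell τ k m' := by
  ext z
  simp only [gridCell, gridChildren, mem_iUnion, mem_ofPred_eq, Fintype.mem_piFinset,
    Finset.mem_insert, Finset.mem_singleton, exists_prop, exists_eq_right']
  rw [funext_iff]
  refine forall_congr' fun i => ?_
  rw [gridIndex_succ]
  omega

theorem lintegral_gridCell_succ {d : ℕ} (τ : Fin d → ℝ) (k : ℤ) (m : Fin d → ℤ)
    (f : (Fin d → ℝ) → ℝ≥0∞) :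
    ∫⁻ z in gridCell τ (k + 1) m, f z = ∑ m' ∈ gridChildren m, ∫⁻ z in gridCell τ k m', f z := by
  rw [gridCell_succ, lintegral_biUnion_finset _ fun m' _ => measurableSet_gridCell τ k m']
  intro m₁ _ m₂ _ hne
  rw [Function.onFun, Set.disjoint_left]
  exact fun z h₁ h₂ => hne (Eq.trans (Eq.symm h₁) h₂)

theorem measurable_gridIndex {d : ℕ} (τ : Fin d → ℝ) (k : ℤ) : Measurable (gridIndex τ k) := by
  refine measurable_pi_iff.2 fun i => ?_
  exact Int.measurable_floor.comp (by fun_prop)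

theorem enorm_average_sub_mul_le {X : Type*} [MeasurableSpace X] {μ : Measure X} {Q : Set X}
    (h0 : μ Q ≠ 0) (ht : μ Q ≠ ⊤) {b : X → ℝ} (hb : IntegrableOn b Q μ) (c : ℝ) :
    ‖(⨍ z in Q, b z ∂μ) - c‖ₑ * μ Q ≤ ∫⁻ z in Q, ‖b z - c‖ₑ ∂μ := by
  have hc : IntegrableOn (fun _ => c) Q μ := integrableOn_const ht
  have hr : μ.real Q ≠ 0 := by simp [Measure.real, ENNReal.toReal_eq_zero_iff, h0, ht]
  have h1 : ((⨍ z in Q, b z ∂μ) - c) * μ.real Q = ∫ z in Q, (b z - c) ∂μ := by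
    rw [integral_sub hb hc, setAverage_eq, setIntegral_const, smul_eq_mul, smul_eq_mul]
    field_simp
  have h2 : μ Q = ‖μ.real Q‖ₑ := by
    rw [Real.enorm_of_nonneg measureReal_nonneg, Measure.real, ENNReal.ofReal_toReal ht]
  rw [h2, ← enorm_mul, h1]
  exact enorm_integral_le_lintegral_enorm _

/-- `b` has mean oscillation at most one on every closed cube of `Fin d → ℝ`. -/
def PiBMO {d : ℕ} (b : (Fin d → ℝ) → ℝ) : Prop :=
  LocallyIntegrable b volume ∧ ∀ (a : Fin d → ℝ) (l : ℝ), 0 < l →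
    (⨍ z in Icc a (fun i => a i + l), |b z - ⨍ w in Icc a (fun i => a i + l), b w|) ≤ 1

/-- The average of `b` over the grid cell with index `m`. -/
def gridAverage {d : ℕ} (b : (Fin d → ℝ) → ℝ) (τ : Fin d → ℝ) (k : ℤ) (m : Fin d → ℤ) : ℝ :=
  ⨍ z in gridCell τ k m, b z

section JohnNirenberg

variable {d : ℕ} {b : (Fin d → ℝ) → ℝ} (τ : Fin d → ℝ)

theorem integrableOn_gridCell (hb : LocallyIntegrable b volume) (k : ℤ) (m : Fin d → ℤ) :
    IntegrableOn b (gridCell τ k m) := by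
  rw [integrableOn_congr_set_ae (gridCell_ae_eq_Icc τ k m)]
  exact hb.integrableOn_isCompact isCompact_Icc

theorem PiBMO.lintegral_gridCell_le (hb : PiBMO b) (k : ℤ) (m : Fin d → ℤ) :
    ∫⁻ z in gridCell τ k m, ‖b z - gridAverage b τ k m‖ₑ ≤ volume (gridCell τ k m) := by
  have hi : IntegrableOn (fun z => b z - gridAverage b τ k m) (gridCell τ k m) :=
    (integrableOn_gridCell τ hb.1 k m).sub (integrableOn_const (volume_gridCell_ne_top τ k m))
  have h := hb.2 (fun i => τ i + 2 ^ k * (m i : ℝ)) (2 ^ k) (by positivity)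
  rw [← setAverage_congr (gridCell_ae_eq_Icc τ k m), ← setAverage_congr (gridCell_ae_eq_Icc τ k m),
    setAverage_eq, smul_eq_mul, Measure.real, inv_mul_le_iff₀ (ENNReal.toReal_pos (volume_gridCell_ne_zero τ k m)
      (volume_gridCell_ne_top τ k m)), mul_one] at h
  rw [← ofReal_integral_norm_eq_lintegral_enorm hi]
  exact (ENNReal.ofReal_le_ofReal h).trans ENNReal.ofReal_toReal_le

theorem volume_gridCell_succ (k : ℤ) (m m' : Fin d → ℤ) :
    volume (gridCell τ (k + 1) m) = 2 ^ d * volume (gridCell τ k m') := by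
  rw [volume_gridCell, volume_gridCell, zpow_add₀ (by norm_num), zpow_one, mul_comm,
    ENNReal.ofReal_mul (by norm_num), mul_pow]
  norm_num

theorem PiBMO.enorm_gridAverage_sub_le (hb : PiBMO b) (k : ℤ) {m m' : Fin d → ℤ}
    (hm : m' ∈ gridChildren m) :
    ‖gridAverage b τ k m' - gridAverage b τ (k + 1) m‖ₑ ≤ 2 ^ d := by
  have h0 := volume_gridCell_ne_zero τ k m'
  have ht := volume_gridCell_ne_top τ k m'
  rw [← ENNReal.mul_le_mul_iff_left h0 ht]
  refine (enorm_average_sub_mul_le h0 ht (integrableOn_gridCell τ hb.1 k m') _).trans ?_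
  rw [← volume_gridCell_succ τ k m m']
  refine le_trans (lintegral_mono_set ?_) (hb.lintegral_gridCell_le τ (k + 1) m)
  rw [gridCell_succ]
  exact subset_biUnion_of_mem (u := fun m' => gridCell τ k m') hm

/-- The measure of the union of the maximal cells, of side at least `2^n` and strictly inside the
cell `(n + r, m)`, on which the average of `b` differs from `c` by more than `L`. -/
def stoppedVolume (b : (Fin d → ℝ) → ℝ) (τ : Fin d → ℝ) (n : ℤ) (c : ℝ) (L : ℝ≥0∞) :
    ℕ → (Fin d → ℤ) → ℝ≥0∞
  | 0, _ => 0
  | r + 1, m => ∑ m' ∈ gridChildren m, open Classical in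
      if L < ‖gridAverage b τ (n + r) m' - c‖ₑ then volume (gridCell τ (n + r) m')
      else stoppedVolume b τ n c L r m'

theorem mul_stoppedVolume_le (hb : LocallyIntegrable b volume) (n : ℤ) (c : ℝ) (L : ℝ≥0∞) (r : ℕ)
    (m : Fin d → ℤ) :
    L * stoppedVolume b τ n c L r m ≤ ∫⁻ z in gridCell τ (n + r) m, ‖b z - c‖ₑ := by
  induction r generalizing m with
  | zero => simp [stoppedVolume]
  | succ r ih =>
    rw [stoppedVolume, Finset.mul_sum, Nat.cast_succ, ← add_assoc, lintegral_gridCell_succ]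
    refine Finset.sum_le_sum fun m' _ => ?_
    split_ifs with h
    · refine le_trans ?_ (enorm_average_sub_mul_le (volume_gridCell_ne_zero τ _ m')
        (volume_gridCell_ne_top τ _ m') (integrableOn_gridCell τ hb _ m') c)
      gcongr
      exact h.le
    · exact ih m'

/-- The average of `b` over the cell of side `2^n` containing `z`. -/
def gridProj (b : (Fin d → ℝ) → ℝ) (τ : Fin d → ℝ) (n : ℤ) (z : Fin d → ℝ) : ℝ :=
  gridAverage b τ n (gridIndex τ n z)

theorem measurable_gridProj (n : ℤ) : Measurable (gridProj b τ n) :=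
  (Measurable.of_discrete (f := gridAverage b τ n)).comp (measurable_gridIndex τ n)

theorem ENNReal.add_pow_le_two_pow_mul (x y : ℝ≥0∞) (N : ℕ) :
    (x + y) ^ N ≤ 2 ^ N * (x ^ N + y ^ N) := by
  rcases le_total x y with h | h
  · calc (x + y) ^ N ≤ (2 * y) ^ N := by rw [two_mul]; gcongr
      _ = 2 ^ N * y ^ N := mul_pow _ _ _
      _ ≤ _ := by gcongr; exact le_add_self
  · calc (x + y) ^ N ≤ (2 * x) ^ N := by rw [two_mul]; gcongr
      _ = 2 ^ N * x ^ N := mul_pow _ _ _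
      _ ≤ _ := by gcongr; exact le_self_add

theorem lintegral_gridProj_zero (n : ℤ) (c : ℝ) (N : ℕ) (m : Fin d → ℤ) :
    ∫⁻ z in gridCell τ n m, ‖gridProj b τ n z - c‖ₑ ^ N =
      ‖gridAverage b τ n m - c‖ₑ ^ N * volume (gridCell τ n m) := by
  rw [← setLIntegral_const]
  refine setLIntegral_congr_fun (measurableSet_gridCell τ n m) fun z hz => ?_
  have : gridIndex τ n z = m := hz
  simp only [gridProj, this]

theorem PiBMO.lintegral_gridProj_le_stoppedVolume (hb : PiBMO b) (n : ℤ) (N : ℕ) (L B : ℝ≥0∞)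
    (R : ℕ) (hB : ∀ r < R, ∀ m, ∫⁻ z in gridCell τ (n + r) m,
      ‖gridProj b τ n z - gridAverage b τ (n + r) m‖ₑ ^ N ≤ B * volume (gridCell τ (n + r) m))
    (r : ℕ) (hr : r ≤ R) (m : Fin d → ℤ) (c : ℝ) (hc : ‖gridAverage b τ (n + r) m - c‖ₑ ≤ L) :
    ∫⁻ z in gridCell τ (n + r) m, ‖gridProj b τ n z - c‖ₑ ^ N ≤
      L ^ N * volume (gridCell τ (n + r) m) +
        2 ^ N * (B + (2 ^ d + L) ^ N) * stoppedVolume b τ n c L r m := by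
  induction r generalizing m with
  | zero =>
    refine le_trans ?_ le_self_add
    rw [Nat.cast_zero, add_zero] at hc ⊢
    rw [lintegral_gridProj_zero]
    gcongr
  | succ r ih =>
    have e : n + ((r + 1 : ℕ) : ℤ) = n + r + 1 := by push_cast; ring
    rw [e] at hc ⊢
    have hvol : volume (gridCell τ (n + r + 1) m) =
        ∑ m' ∈ gridChildren m, volume (gridCell τ (n + r) m') := by
      simpa using lintegral_gridCell_succ τ (n + r) m 1
    rw [lintegral_gridCell_succ, hvol, stoppedVolume, Finset.mul_sum, Finset.mul_sum,
      ← Finset.sum_add_distrib]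
    refine Finset.sum_le_sum fun m' hm' => ?_
    split_ifs with h
    · refine le_trans ?_ le_add_self
      have h1 : ‖gridAverage b τ (n + r) m' - c‖ₑ ≤ 2 ^ d + L := by
        rw [← sub_add_sub_cancel _ (gridAverage b τ (n + r + 1) m) c]
        exact (enorm_add_le _ _).trans (add_le_add (hb.enorm_gridAverage_sub_le τ _ hm') hc)
      calc ∫⁻ z in gridCell τ (n + r) m', ‖gridProj b τ n z - c‖ₑ ^ N
          ≤ ∫⁻ z in gridCell τ (n + r) m', 2 ^ N *
            (‖gridProj b τ n z - gridAverage b τ (n + r) m'‖ₑ ^ N + (2 ^ d + L) ^ N) := by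
            refine lintegral_mono fun z => ?_
            rw [← sub_add_sub_cancel _ (gridAverage b τ (n + r) m') c]
            refine (pow_le_pow_left' (enorm_add_le _ _) N).trans
              ((ENNReal.add_pow_le_two_pow_mul _ _ N).trans ?_)
            gcongr
        _ = 2 ^ N * ((∫⁻ z in gridCell τ (n + r) m',
            ‖gridProj b τ n z - gridAverage b τ (n + r) m'‖ₑ ^ N) +
              (2 ^ d + L) ^ N * volume (gridCell τ (n + r) m')) := by
            rw [lintegral_const_mul' _ _ (by finiteness), lintegral_add_right _ measurable_const,
              setLIntegral_const]
        _ ≤ 2 ^ N * (B * volume (gridCell τ (n + r) m') +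
              (2 ^ d + L) ^ N * volume (gridCell τ (n + r) m')) := by
            gcongr
            exact hB r (by omega) m'
        _ = _ := by ring
    · exact ih (by omega) m' (not_lt.1 h)

theorem PiBMO.lintegral_gridProj_le (hb : PiBMO b) (n : ℤ) (N r : ℕ) (m : Fin d → ℤ) :
    ∫⁻ z in gridCell τ (n + r) m, ‖gridProj b τ n z - gridAverage b τ (n + r) m‖ₑ ^ N ≤
      (2 * (2 ^ (N + 1)) ^ N + (2 ^ d + 2 ^ (N + 1)) ^ N) * volume (gridCell τ (n + r) m) := by
  induction r using Nat.strong_induction_on generalizing m with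
  | _ r ih =>
    set L : ℝ≥0∞ := 2 ^ (N + 1)
    set K : ℝ≥0∞ := (2 ^ d + L) ^ N with hK
    set V := volume (gridCell τ (n + r) m)
    have hT : L * stoppedVolume b τ n (gridAverage b τ (n + r) m) L r m ≤ V :=
      (mul_stoppedVolume_le τ hb.1 n _ L r m).trans (hb.lintegral_gridCell_le τ _ m)
    refine (hb.lintegral_gridProj_le_stoppedVolume τ n N L _ r ih r le_rfl m _ (by simp)).trans ?_
    set T := stoppedVolume b τ n (gridAverage b τ (n + r) m) L r m
    calc L ^ N * V + 2 ^ N * (2 * L ^ N + K + K) * T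
        = L ^ N * V + (L ^ N + K) * (2 ^ (N + 1) * T) := by ring
      _ ≤ L ^ N * V + (L ^ N + K) * V := by gcongr
      _ = _ := by ring

theorem ae_tendsto_gridProj (hb : LocallyIntegrable b volume) (k : ℤ) :
    ∀ᵐ z, Tendsto (fun r : ℕ => gridProj b τ (k - r) z) atTop (𝓝 (b z)) := by
  filter_upwards [IsUnifLocDoublingMeasure.ae_tendsto_average (μ := volume) hb 1] with z hz
  have hδ : Tendsto (fun r : ℕ => (2:ℝ) ^ (k - (r : ℤ)) / 2) atTop (𝓝[>] 0) := by
    refine tendsto_nhdsWithin_iff.2 ⟨?_, Eventually.of_forall fun r => mem_Ioi.2 (by positivity)⟩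
    have h1 : (fun r : ℕ => (2:ℝ) ^ (k - (r : ℤ)) / 2) =
        fun r : ℕ => (2 ^ k / 2) * (1 / 2 : ℝ) ^ r := by
      ext r
      rw [zpow_sub₀ (by norm_num), zpow_natCast, one_div, inv_pow]
      ring
    rw [h1, ← mul_zero ((2:ℝ) ^ k / 2)]
    exact (tendsto_pow_atTop_nhds_zero_of_lt_one (by norm_num) (by norm_num)).const_mul _
  have hw : ∀ r : ℕ, gridCell τ (k - r) (gridIndex τ (k - r) z) =ᵐ[volume]
      closedBall (fun i => τ i + 2 ^ (k - (r : ℤ)) * (gridIndex τ (k - r) z i : ℝ) +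
        2 ^ (k - (r : ℤ)) / 2) ((2:ℝ) ^ (k - (r : ℤ)) / 2) := fun r => by
    rw [← Icc_eq_closedBall_pi _ (by positivity)]
    exact gridCell_ae_eq_Icc _ _ _
  refine (hz _ _ hδ (Eventually.of_forall fun r => ?_)).congr fun r =>
    (setAverage_congr (hw r)).symm
  rw [one_mul, ← Icc_eq_closedBall_pi _ (by positivity)]
  have h2 : z ∈ gridCell τ (k - r) (gridIndex τ (k - r) z) := rfl
  rw [gridCell_eq_pi] at h2
  refine ⟨fun i => (h2 i trivial).1, fun i => (h2 i trivial).2.le.trans_eq (by ring)⟩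

/-- The `L^N` form of the John–Nirenberg inequality. -/
theorem PiBMO.lintegral_pow_le (hb : PiBMO b) (N : ℕ) (k : ℤ) (m : Fin d → ℤ) :
    ∫⁻ z in gridCell τ k m, ‖b z - gridAverage b τ k m‖ₑ ^ N ≤
      (2 * (2 ^ (N + 1)) ^ N + (2 ^ d + 2 ^ (N + 1)) ^ N) * volume (gridCell τ k m) := by
  set c := gridAverage b τ k m with hc
  have hlim : ∀ᵐ z ∂volume.restrict (gridCell τ k m), ‖b z - c‖ₑ ^ N =
      liminf (fun r : ℕ => ‖gridProj b τ (k - r) z - c‖ₑ ^ N) atTop := by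
    filter_upwards [ae_restrict_of_ae (ae_tendsto_gridProj τ hb.1 k)] with z hz
    exact (((ENNReal.continuous_pow N).tendsto _).comp
      ((continuous_enorm.tendsto _).comp (hz.sub_const c))).liminf_eq.symm
  rw [lintegral_congr_ae hlim]
  refine (lintegral_liminf_le fun r =>
    (((measurable_gridProj τ _).sub_const c).enorm.pow_const N)).trans ?_
  refine liminf_le_of_le (by isBoundedDefault) fun x hx => ?_
  obtain ⟨r, hr⟩ := hx.exists
  refine hr.trans ?_
  have h := hb.lintegral_gridProj_le τ (k - r) N r m
  rwa [sub_add_cancel] at h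

end JohnNirenberg

/-- The two coordinate shifts of the dyadic grid used at scales up to `2^T`. -/
def gridShift (T : ℤ) (t : Bool) : ℝ := bif t then 2 ^ T / 3 else 0

theorem exists_gridShift_floor_eq {k T : ℤ} (hk : k ≤ T) {u v : ℝ} (huv : u ≤ v)
    (h : v - u < 2 ^ k / 3) :
    ∃ t : Bool, ⌊(u - gridShift T t) / 2 ^ k⌋ = ⌊(v - gridShift T t) / 2 ^ k⌋ := by
  by_contra! hne
  have h2 : (0:ℝ) < 2 ^ k := by positivity
  have key : ∀ t : Bool, ∃ a : ℤ, (u - gridShift T t) / 2 ^ k < a ∧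
      (a : ℝ) ≤ (v - gridShift T t) / 2 ^ k := fun t => by
    have hle : ⌊(u - gridShift T t) / 2 ^ k⌋ ≤ ⌊(v - gridShift T t) / 2 ^ k⌋ :=
      Int.floor_le_floor (by gcongr)
    exact ⟨_, Int.floor_lt.1 (lt_of_le_of_ne hle (hne t)), Int.floor_le _⟩
  obtain ⟨a, ha, ha'⟩ := key false
  obtain ⟨a', hb, hb'⟩ := key true
  obtain ⟨r, rfl⟩ : ∃ r : ℕ, T = k + r := ⟨(T - k).toNat, by omega⟩
  simp only [gridShift, cond_false, cond_true, sub_zero] at ha ha' hb hb'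
  have e : ∀ y : ℝ, (y - 2 ^ (k + (r : ℤ)) / 3) / 2 ^ k = y / 2 ^ k - 2 ^ r / 3 := fun y => by
    rw [zpow_add₀ (by norm_num), zpow_natCast]; field_simp
  rw [e] at hb hb'
  have h' : v / 2 ^ k - u / 2 ^ k < 1 / 3 := by
    rw [← sub_div, div_lt_iff₀ h2]; linarith
  have h3 : (3 * (a - a') : ℤ) - 2 ^ r < (1 : ℤ) := by
    rw [← @Int.cast_lt ℝ]; push_cast; linarith
  have h4 : (-1 : ℤ) < (3 * (a - a') : ℤ) - 2 ^ r := by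
    rw [← @Int.cast_lt ℝ]; push_cast; linarith
  have h5 : (3 : ℤ) ∣ 2 ^ r := ⟨a - a', by linarith⟩
  have h6 := Int.Prime.dvd_pow' Nat.prime_three h5
  omega

theorem exists_Icc_subset_gridCell {d : ℕ} {k T : ℤ} (hk : k ≤ T) {u v : Fin d → ℝ}
    (huv : ∀ l, u l ≤ v l) (h : ∀ l, v l - u l < 2 ^ k / 3) :
    ∃ (t : Fin d → Bool) (m : Fin d → ℤ),
      Icc u v ⊆ gridCell (fun l => gridShift T (t l)) k m := by
  choose t ht using fun l => exists_gridShift_floor_eq hk (huv l) (h l)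
  refine ⟨t, gridIndex (fun l => gridShift T (t l)) k u, fun z hz => funext fun l => ?_⟩
  refine le_antisymm ?_ (Int.floor_le_floor ?_)
  · rw [gridIndex, gridIndex, ht l]
    refine Int.floor_le_floor ?_
    gcongr
    exact hz.2 l
  · gcongr
    exact hz.1 l

theorem ENNReal.mul_pow_le_half_add (x y : ℝ≥0∞) (n : ℕ) :
    x * y ^ n ≤ 2⁻¹ * y ^ (n + 1) + 2 ^ n * x ^ (n + 1) := by
  rcases le_total (2 * x) y with h | h
  · refine le_trans ?_ le_self_add
    calc x * y ^ n = (2⁻¹ * 2) * (x * y ^ n) := by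
          rw [ENNReal.inv_mul_cancel (by simp) (by simp), one_mul]
      _ = 2⁻¹ * (2 * x * y ^ n) := by ring
      _ ≤ 2⁻¹ * (y * y ^ n) := by gcongr
      _ = _ := by ring
  · refine le_trans ?_ le_add_self
    calc x * y ^ n ≤ x * (2 * x) ^ n := by gcongr
      _ = _ := by rw [mul_pow]; ring

theorem pow_mul_measure_le_lintegral_pow {X : Type*} [MeasurableSpace X] {μ : Measure X}
    {E : Set X} (hE : μ E ≠ ⊤) {f : X → ℝ≥0∞} {c : ℝ≥0∞} (hc : c ≠ ⊤)
    (h : c * μ E ≤ ∫⁻ z in E, f z ∂μ) (n : ℕ) :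
    c ^ (n + 1) * μ E ≤ 2 ^ (n + 1) * ∫⁻ z in E, f z ^ (n + 1) ∂μ := by
  set A := c ^ (n + 1) * μ E with hA
  have hAt : A ≠ ⊤ := by finiteness
  have h1 : A ≤ 2⁻¹ * A + 2 ^ n * ∫⁻ z in E, f z ^ (n + 1) ∂μ := by
    calc A = c * μ E * c ^ n := by rw [hA]; ring
      _ ≤ (∫⁻ z in E, f z ∂μ) * c ^ n := by gcongr
      _ = ∫⁻ z in E, f z * c ^ n ∂μ := (lintegral_mul_const' _ _ (by finiteness)).symm
      _ ≤ ∫⁻ z in E, (2⁻¹ * c ^ (n + 1) + 2 ^ n * f z ^ (n + 1)) ∂μ :=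
          lintegral_mono fun z => ENNReal.mul_pow_le_half_add _ _ _
      _ = _ := by
          rw [lintegral_add_left measurable_const, setLIntegral_const,
            lintegral_const_mul' _ _ (by finiteness), hA, mul_assoc]
  have h2 : 2⁻¹ * A ≠ ⊤ := by finiteness
  have h3 : 2⁻¹ * A + 2⁻¹ * A = A := by rw [← add_mul, ENNReal.inv_two_add_inv_two, one_mul]
  have h4 : 2⁻¹ * A ≤ 2 ^ n * ∫⁻ z in E, f z ^ (n + 1) ∂μ := by
    rw [← ENNReal.add_le_add_iff_left h2, h3]
    exact h1
  calc A = 2 * (2⁻¹ * A) := by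
        rw [← mul_assoc, ENNReal.mul_inv_cancel (by simp) (by simp), one_mul]
    _ ≤ 2 * (2 ^ n * ∫⁻ z in E, f z ^ (n + 1) ∂μ) := by gcongr
    _ = _ := by ring

theorem ENNReal.sum_pow_succ_le_card_pow_mul {ι : Type*} (s : Finset ι) (f : ι → ℝ≥0∞) (n : ℕ) :
    (∑ i ∈ s, f i) ^ (n + 1) ≤ (s.card : ℝ≥0∞) ^ n * ∑ i ∈ s, f i ^ (n + 1) := by
  have h := ENNReal.rpow_sum_le_const_mul_sum_rpow s f (p := ((n + 1 : ℕ) : ℝ)) (by simp)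
  have e : ((n + 1 : ℕ) : ℝ) - 1 = (n : ℝ) := by push_cast; ring
  simpa only [e, ENNReal.rpow_natCast] using h

/-- `lintegral_sum_indicator_pow_le` for cells taken from the `2^d` shifted dyadic grids. -/
theorem lintegral_sum_gridCell_pow_le {d : ℕ} {J : Type*} (s : Finset J) (T : ℤ)
    (t : J → Fin d → Bool) (k : J → ℤ) (m : J → Fin d → ℤ) (E : J → Set (Fin d → ℝ))
    (κ : ℝ≥0∞) (c : J → ℝ≥0∞) (n : ℕ) (hE : ∀ p, MeasurableSet (E p))
    (hEQ : ∀ p, E p ⊆ gridCell (fun l => gridShift T (t p l)) (k p) (m p))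
    (hdisj : Pairwise (Function.onFun Disjoint E)) (hκ0 : κ ≠ 0) (hκ : κ ≠ ⊤)
    (hvol : ∀ p, volume (gridCell (fun l => gridShift T (t p l)) (k p) (m p)) ≤ κ * volume (E p))
    (hc : ∀ p, c p ≠ ⊤) :
    ∫⁻ z, (∑ p ∈ s, (gridCell (fun l => gridShift T (t p l)) (k p) (m p)).indicator
        (fun _ => κ⁻¹ * c p) z) ^ (n + 1) ≤
      (2 ^ d) ^ n * (2 * (2 * (n + 1)) ^ (n + 1)) * ∑ p ∈ s, c p ^ (n + 1) * volume (E p) := by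
  classical
  set Q : J → Set (Fin d → ℝ) := fun p => gridCell (fun l => gridShift T (t p l)) (k p) (m p)
  have hQm : ∀ p, MeasurableSet (Q p) := fun p => measurableSet_gridCell _ _ _
  have hsum : ∀ g : J → ℝ≥0∞, ∑ p ∈ s, g p =
      ∑ τ : Fin d → Bool, ∑ p ∈ s with t p = τ, g p := fun g =>
    (Finset.sum_fiberwise s t g).symm
  have hcard : ((Finset.univ : Finset (Fin d → Bool)).card : ℝ≥0∞) = 2 ^ d := by simp
  calc _ ≤ ∫⁻ z, (2 ^ d) ^ n * ∑ τ : Fin d → Bool, (∑ p ∈ s with t p = τ,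
          (Q p).indicator (fun _ => κ⁻¹ * c p) z) ^ (n + 1) := by
        refine lintegral_mono fun z => ?_
        rw [hsum, ← hcard]
        exact ENNReal.sum_pow_succ_le_card_pow_mul _ _ n
    _ = (2 ^ d) ^ n * ∑ τ : Fin d → Bool, ∫⁻ z, (∑ p ∈ s with t p = τ,
          (Q p).indicator (fun _ => κ⁻¹ * c p) z) ^ (n + 1) := by
        rw [lintegral_const_mul' _ _ (by finiteness), lintegral_finsetSum]
        exact fun τ _ => (Finset.measurable_fun_sum _
          fun p _ => measurable_const.indicator (hQm p)).pow_const _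
    _ ≤ (2 ^ d) ^ n * ∑ τ : Fin d → Bool, 2 * (2 * (n + 1)) ^ (n + 1) *
          ∑ p ∈ s with t p = τ, c p ^ (n + 1) * volume (E p) := by
        gcongr with τ _
        refine lintegral_sum_indicator_pow_le volume _ k Q E κ c n hQm hE hEQ
          (hdisj.set_pairwise _) ?_ hκ0 hκ hvol (fun p => volume_gridCell_ne_top _ _ _) hc
        intro p hp p' hp' hk hne
        have h1 : t p = t p' := by
          rw [(Finset.mem_filter.1 hp).2, (Finset.mem_filter.1 hp').2]
        simp only [Q, h1] at hne ⊢
        exact gridCell_subset_of_nonempty hk hne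
    _ = _ := by rw [← Finset.mul_sum, ← hsum]; simp only [mul_assoc]

/-- The constant in the John–Nirenberg inequality for exponent `N`. -/
def johnNirenbergConst (d N : ℕ) : ℝ≥0∞ := 2 * (2 ^ (N + 1)) ^ N + (2 ^ d + 2 ^ (N + 1)) ^ N

/-- The constant in `lintegral_sum_gridCell_pow_le`. -/
def gridSumConst (d n : ℕ) : ℝ≥0∞ := (2 ^ d) ^ n * (2 * (2 * (n + 1)) ^ (n + 1))

theorem johnNirenbergConst_ne_top (d N : ℕ) : johnNirenbergConst d N ≠ ⊤ := by
  unfold johnNirenbergConst; finiteness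

theorem gridSumConst_ne_top (d n : ℕ) : gridSumConst d n ≠ ⊤ := by
  unfold gridSumConst; finiteness

theorem PiBMO.lintegral_sum_gridCell_le {d : ℕ} {b : (Fin d → ℝ) → ℝ} (hb : PiBMO b)
    {J : Type*} (s : Finset J) (T : ℤ)
    (t : J → Fin d → Bool) (k : J → ℤ) (m : J → Fin d → ℤ) (E : J → Set (Fin d → ℝ))
    (κ : ℝ≥0∞) (n : ℕ) (hE : ∀ p, MeasurableSet (E p))
    (hEQ : ∀ p, E p ⊆ gridCell (fun l => gridShift T (t p l)) (k p) (m p))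
    (hdisj : Pairwise (Function.onFun Disjoint E)) (hκ0 : κ ≠ 0) (hκ : κ ≠ ⊤)
    (hvol : ∀ p, volume (gridCell (fun l => gridShift T (t p l)) (k p) (m p)) ≤ κ * volume (E p))
    (hE0 : ∀ p, volume (E p) ≠ 0)
    (τ : Fin d → ℝ) (K : ℤ) (M : Fin d → ℤ) (hER : ∀ p, E p ⊆ gridCell τ K M) :
    ∫⁻ z in gridCell τ K M, (∑ p ∈ s, (gridCell (fun l => gridShift T (t p l)) (k p) (m p)).indicator
        (fun z => κ⁻¹ * ‖b z - ⨍ w in E p, b w‖ₑ) z) ^ (n + 1) ≤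
      2 ^ (n + 1) * (johnNirenbergConst d (2 * (n + 1)) + gridSumConst d (2 * n + 1) +
        gridSumConst d n * (2 ^ (n + 1) * johnNirenbergConst d (n + 1))) *
          volume (gridCell τ K M) := by
  set R := gridCell τ K M with hR
  set a := gridAverage b τ K M with ha
  set Q : J → Set (Fin d → ℝ) := fun p => gridCell (fun l => gridShift T (t p l)) (k p) (m p)
    with hQ
  have hQm : ∀ p, MeasurableSet (Q p) := fun p => measurableSet_gridCell _ _ _
  have hRt : volume R ≠ ⊤ := volume_gridCell_ne_top τ K M
  have hEt : ∀ p, volume (E p) ≠ ⊤ := fun p => ((measure_mono (hER p)).trans_lt hRt.lt_top).ne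
  have hsumE : ∀ g : (Fin d → ℝ) → ℝ≥0∞, ∑ p ∈ s, ∫⁻ z in E p, g z ≤ ∫⁻ z in R, g z := fun g => by
    rw [← lintegral_biUnion_finset (hdisj.set_pairwise _) fun p _ => hE p]
    exact lintegral_mono_set (iUnion₂_subset fun p _ => hER p)
  set c : J → ℝ≥0∞ := fun p => ‖(⨍ w in E p, b w) - a‖ₑ with hc
  have hct : ∀ p, c p ≠ ⊤ := fun p => enorm_ne_top
  set G : (Fin d → ℝ) → ℝ≥0∞ := fun z => ∑ p ∈ s, (Q p).indicator (fun _ => κ⁻¹ * 1) z with hG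
  set H : (Fin d → ℝ) → ℝ≥0∞ := fun z => ∑ p ∈ s, (Q p).indicator (fun _ => κ⁻¹ * c p) z with hH
  have hGm : Measurable G := Finset.measurable_fun_sum _ fun p _ =>
    measurable_const.indicator (hQm p)
  have hHm : Measurable H := Finset.measurable_fun_sum _ fun p _ =>
    measurable_const.indicator (hQm p)
  have hpt : ∀ z, (∑ p ∈ s, (Q p).indicator (fun z => κ⁻¹ * ‖b z - ⨍ w in E p, b w‖ₑ) z) ^ (n + 1) ≤
      2 ^ (n + 1) * (‖b z - a‖ₑ ^ (2 * (n + 1)) + G z ^ (2 * n + 1 + 1) + H z ^ (n + 1)) := by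
    intro z
    have h1 : ∑ p ∈ s, (Q p).indicator (fun z => κ⁻¹ * ‖b z - ⨍ w in E p, b w‖ₑ) z ≤
        ‖b z - a‖ₑ * G z + H z := by
      rw [hG, hH, Finset.mul_sum, ← Finset.sum_add_distrib]
      refine Finset.sum_le_sum fun p _ => ?_
      by_cases hz : z ∈ Q p
      · simp only [indicator_of_mem hz]
        have h2 : ‖b z - ⨍ w in E p, b w‖ₑ ≤ ‖b z - a‖ₑ + c p := by
          calc _ = ‖(b z - a) - ((⨍ w in E p, b w) - a)‖ₑ := by congr 1; ring
            _ ≤ _ := enorm_sub_le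
        calc _ ≤ κ⁻¹ * (‖b z - a‖ₑ + c p) := by gcongr
          _ = _ := by ring
      · simp [indicator_of_notMem hz]
    have h3 : (‖b z - a‖ₑ * G z) ^ (n + 1) ≤
        ‖b z - a‖ₑ ^ (2 * (n + 1)) + G z ^ (2 * n + 1 + 1) := by
      have h4 : ∀ u v : ℝ≥0∞, u * v ≤ u ^ 2 + v ^ 2 := fun u v => by
        rcases le_total u v with h | h
        · exact (mul_le_mul_left h v).trans (by rw [← sq]; exact le_add_self)
        · exact (mul_le_mul_right h u).trans (by rw [← sq]; exact le_self_add)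
      rw [mul_pow]
      refine (h4 _ _).trans (le_of_eq ?_)
      rw [← pow_mul, ← pow_mul]
      congr 2 <;> ring
    calc _ ≤ (‖b z - a‖ₑ * G z + H z) ^ (n + 1) := by gcongr
      _ ≤ 2 ^ (n + 1) * ((‖b z - a‖ₑ * G z) ^ (n + 1) + H z ^ (n + 1)) :=
          ENNReal.add_pow_le_two_pow_mul _ _ _
      _ ≤ _ := by gcongr
  have hGi : ∫⁻ z in R, G z ^ (2 * n + 1 + 1) ≤ gridSumConst d (2 * n + 1) * volume R := by
    refine (setLIntegral_le_lintegral _ _).trans ((lintegral_sum_gridCell_pow_le s T t k m E κ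
      (fun _ => 1) (2 * n + 1) hE hEQ hdisj hκ0 hκ hvol (by simp)).trans ?_)
    unfold gridSumConst
    gcongr
    simpa using hsumE 1
  have hHi : ∫⁻ z in R, H z ^ (n + 1) ≤
      gridSumConst d n * (2 ^ (n + 1) * johnNirenbergConst d (n + 1)) * volume R := by
    refine (setLIntegral_le_lintegral _ _).trans ((lintegral_sum_gridCell_pow_le s T t k m E κ
      c n hE hEQ hdisj hκ0 hκ hvol hct).trans ?_)
    rw [mul_assoc (gridSumConst d n)]
    refine mul_le_mul_right ?_ (gridSumConst d n)
    calc ∑ p ∈ s, c p ^ (n + 1) * volume (E p)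
        ≤ ∑ p ∈ s, 2 ^ (n + 1) * ∫⁻ z in E p, ‖b z - a‖ₑ ^ (n + 1) := by
          refine Finset.sum_le_sum fun p _ => ?_
          refine pow_mul_measure_le_lintegral_pow (hEt p) (hct p) ?_ n
          exact enorm_average_sub_mul_le (hE0 p) (hEt p)
            ((integrableOn_gridCell τ hb.1 K M).mono_set (hER p)) a
      _ = 2 ^ (n + 1) * ∑ p ∈ s, ∫⁻ z in E p, ‖b z - a‖ₑ ^ (n + 1) := by rw [Finset.mul_sum]
      _ ≤ 2 ^ (n + 1) * ∫⁻ z in R, ‖b z - a‖ₑ ^ (n + 1) := by gcongr; exact hsumE _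
      _ ≤ 2 ^ (n + 1) * (johnNirenbergConst d (n + 1) * volume R) := by
          gcongr; exact hb.lintegral_pow_le τ (n + 1) K M
      _ = _ := (mul_assoc _ _ _).symm
  calc _ ≤ ∫⁻ z in R, 2 ^ (n + 1) *
        (‖b z - a‖ₑ ^ (2 * (n + 1)) + G z ^ (2 * n + 1 + 1) + H z ^ (n + 1)) :=
        lintegral_mono hpt
    _ = 2 ^ (n + 1) * ((∫⁻ z in R, ‖b z - a‖ₑ ^ (2 * (n + 1))) +
          (∫⁻ z in R, G z ^ (2 * n + 1 + 1)) + ∫⁻ z in R, H z ^ (n + 1)) := by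
        rw [lintegral_const_mul' _ _ (by finiteness), lintegral_add_right _ (hHm.pow_const _),
          lintegral_add_right _ (hGm.pow_const _)]
    _ ≤ 2 ^ (n + 1) * (johnNirenbergConst d (2 * (n + 1)) * volume R +
          gridSumConst d (2 * n + 1) * volume R +
          gridSumConst d n * (2 ^ (n + 1) * johnNirenbergConst d (n + 1)) * volume R) := by
        refine mul_le_mul_right (add_le_add (add_le_add ?_ hGi) hHi) _
        exact hb.lintegral_pow_le τ (2 * (n + 1)) K M
    _ = _ := by ring

theorem PiBMO.lintegral_tsum_pow_le {d : ℕ} (hd : 0 < d) (n : ℕ) : ∃ C : ℝ≥0∞, C ≠ ⊤ ∧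
    ∀ b : (Fin d → ℝ) → ℝ, PiBMO b → ∀ (s : ℕ) (j : ℤ) (x : Fin d → ℝ)
      (J : Type) [Countable J] (c : J → Fin d → ℝ) (i : J → ℤ), (∀ p, i p ≤ j) →
      Pairwise (Function.onFun Disjoint fun p =>
        univ.pi fun l => Ioo (c p l) (c p l + 2 ^ (i p - s))) →
      (∀ p, Icc (c p) (fun l => c p l + 2 ^ (i p - s)) ⊆
        Icc (fun l => x l - 2 ^ (j + 4) * d) (fun l => x l + 2 ^ (j + 4) * d)) →
      ∫⁻ z in Icc (fun l => x l - 2 ^ (j + 4) * d) (fun l => x l + 2 ^ (j + 4) * d),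
        (∑' p, (Icc (fun l => c p l - 2 ^ (i p + 1))
            (fun l => c p l + 2 ^ (i p - s) + 2 ^ (i p + 1))).indicator
          (fun z => ((2 ^ s) ^ d)⁻¹ *
            ‖b z - ⨍ w in Icc (c p) (fun l => c p l + 2 ^ (i p - s)), b w‖ₑ) z) ^ (n + 1) ≤
      C * volume (Icc (fun l => x l - (2:ℝ) ^ (j + 4) * d) (fun l => x l + 2 ^ (j + 4) * d)) := by
  set C₀ := 2 ^ (n + 1) * (johnNirenbergConst d (2 * (n + 1)) + gridSumConst d (2 * n + 1) +
        gridSumConst d n * (2 ^ (n + 1) * johnNirenbergConst d (n + 1))) with hC₀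
  have hC₀t : C₀ ≠ ⊤ := by
    have h1 := johnNirenbergConst_ne_top d
    have h2 := gridSumConst_ne_top d
    simp only [hC₀]
    finiteness [h1 (2 * (n + 1)), h1 (n + 1), h2 n, h2 (2 * n + 1)]
  refine ⟨(32 ^ d) ^ (n + 1) * (C₀ * (2 ^ d) ^ d), by finiteness, ?_⟩
  intro b hb s j x J _ c i hij hdisj hsub
  set R := Icc (fun l => x l - (2:ℝ) ^ (j + 4) * d) (fun l => x l + 2 ^ (j + 4) * d) with hR
  set E : J → Set (Fin d → ℝ) := fun p => univ.pi fun l => Ioo (c p l) (c p l + 2 ^ (i p - s))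
    with hE
  set R' := gridCell (fun l => x l - (2:ℝ) ^ (j + 4) * d) (j + 5 + d) 0 with hR'
  have hd2 : (d : ℝ) < 2 ^ d := by exact_mod_cast d.lt_two_pow_self
  have hd1 : (1 : ℝ) ≤ d := by exact_mod_cast hd
  have hj : (0:ℝ) < 2 ^ (j + 4) := by positivity
  have hj5 : (2:ℝ) ^ (j + 5) = 2 * 2 ^ (j + 4) := by
    rw [show j + 5 = 1 + (j + 4) by ring, zpow_add₀ (by norm_num), zpow_one]
  have hj5d : (2:ℝ) ^ (j + 5 + d) = 2 ^ (j + 5) * 2 ^ d := by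
    rw [zpow_add₀ (by norm_num), zpow_natCast]
  have hRR' : R ⊆ R' := by
    intro z hz
    rw [hR', gridCell_eq_pi]
    intro l _
    have h1 := hz.1 l
    have h2 := hz.2 l
    simp only [Pi.zero_apply, Int.cast_zero, mul_zero, add_zero, zero_add, mul_one, mem_Ico] at h1 h2 ⊢
    refine ⟨h1, ?_⟩
    rw [hj5d, hj5]
    nlinarith
  have hvolR' : volume R' ≤ (2 ^ d) ^ d * volume R := by
    rw [hR', volume_gridCell, hR, Real.volume_Icc_pi]
    have : ∀ l, x l + (2:ℝ) ^ (j + 4) * d - (x l - 2 ^ (j + 4) * d) = 2 ^ (j + 5) * d := fun l => by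
      rw [hj5]; ring
    simp only [this, Finset.prod_const, Finset.card_univ, Fintype.card_fin]
    rw [← mul_pow]
    gcongr
    rw [hj5d, mul_comm, ENNReal.ofReal_mul (by positivity), ENNReal.ofReal_pow (by norm_num),
      ENNReal.ofReal_ofNat]
    gcongr
    exact le_mul_of_one_le_right (by positivity) hd1
  have hi : ∀ p, (2:ℝ) ^ (i p - s) ≤ 2 ^ i p := fun p =>
    zpow_le_zpow_right₀ (by norm_num) (by omega)
  have hi0 : ∀ p, (0:ℝ) < 2 ^ (i p - s) := fun p => by positivity
  have hcell : ∀ p, ∃ (t : Fin d → Bool) (m : Fin d → ℤ),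
      Icc (fun l => c p l - 2 ^ (i p + 1)) (fun l => c p l + 2 ^ (i p - s) + 2 ^ (i p + 1)) ⊆
        gridCell (fun l => gridShift (j + 5) (t l)) (i p + 5) m := fun p => by
    have h1 : (2:ℝ) ^ (i p + 1) = 2 * 2 ^ i p := by
      rw [zpow_add₀ (by norm_num), zpow_one, mul_comm]
    have h5 : (2:ℝ) ^ (i p + 5) = 32 * 2 ^ i p := by
      rw [zpow_add₀ (by norm_num), mul_comm]; norm_num
    have h0 := hi0 p
    have h2 := hi p
    refine exists_Icc_subset_gridCell (by have := hij p; omega) (fun l => ?_) fun l => ?_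
    · simp only [h1]; linarith
    · simp only [h1, h5]; linarith
  choose t m htm using hcell
  set Q : J → Set (Fin d → ℝ) := fun p =>
    gridCell (fun l => gridShift (j + 5) (t p l)) (i p + 5) (m p) with hQ
  set κ : ℝ≥0∞ := (2 ^ (s + 5)) ^ d with hκ
  have hEI : ∀ p, E p ⊆ Icc (c p) (fun l => c p l + 2 ^ (i p - s)) := fun p z hz =>
    ⟨fun l => (hz l trivial).1.le, fun l => (hz l trivial).2.le⟩
  have hEae : ∀ p, E p =ᵐ[volume] Icc (c p) (fun l => c p l + 2 ^ (i p - s)) := fun p =>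
    Measure.univ_pi_Ioo_ae_eq_Icc
  have hEv : ∀ p, volume (E p) = ENNReal.ofReal (2 ^ (i p - s)) ^ d := fun p => by
    rw [hE, Real.volume_pi_Ioo]
    simp
  have hEm : ∀ p, MeasurableSet (E p) := fun p => MeasurableSet.univ_pi fun l => measurableSet_Ioo
  have hEQ : ∀ p, E p ⊆ Q p := fun p => (hEI p).trans <| (Icc_subset_Icc
    (fun l => by have : (0:ℝ) < 2 ^ (i p + 1) := by positivity
                 simp only; linarith)
    (fun l => by have : (0:ℝ) < 2 ^ (i p + 1) := by positivity
                 simp only; linarith)).trans (htm p)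
  have hvol : ∀ p, volume (Q p) ≤ κ * volume (E p) := fun p => by
    rw [hEv, hQ, volume_gridCell, hκ, ← mul_pow,
      show i p + 5 = ((s + 5 : ℕ) : ℤ) + (i p - s) by push_cast; ring, zpow_add₀ (by norm_num),
      zpow_natCast, ENNReal.ofReal_mul (by positivity), ENNReal.ofReal_pow (by norm_num),
      ENNReal.ofReal_ofNat]
  have hκ0 : κ ≠ 0 := by simp [hκ]
  have hκt : κ ≠ ⊤ := by finiteness
  have hκs : ((2 ^ s) ^ d)⁻¹ = 32 ^ d * κ⁻¹ := by
    rw [hκ, pow_add, mul_pow, ENNReal.mul_inv (by simp) (by simp), mul_comm, mul_assoc]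
    norm_num
    rw [ENNReal.inv_mul_cancel (by simp) (by finiteness), mul_one]
  have hfin : ∀ F : Finset J, ∫⁻ z in R, (∑ p ∈ F, (Icc (fun l => c p l - 2 ^ (i p + 1))
            (fun l => c p l + 2 ^ (i p - s) + 2 ^ (i p + 1))).indicator
          (fun z => ((2 ^ s) ^ d)⁻¹ *
            ‖b z - ⨍ w in Icc (c p) (fun l => c p l + 2 ^ (i p - s)), b w‖ₑ) z) ^ (n + 1) ≤
      (32 ^ d) ^ (n + 1) * (C₀ * (2 ^ d) ^ d) * volume R := fun F => by
    calc _ ≤ ∫⁻ z in R', (32 ^ d) ^ (n + 1) * (∑ p ∈ F, (Q p).indicator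
            (fun z => κ⁻¹ * ‖b z - ⨍ w in E p, b w‖ₑ) z) ^ (n + 1) := by
          refine (lintegral_mono_set hRR').trans (lintegral_mono fun z => ?_)
          rw [← mul_pow, Finset.mul_sum]
          gcongr with p _
          simp only [setAverage_congr (hEae p)]
          rw [hκs]
          by_cases hz : z ∈ Icc (fun l => c p l - 2 ^ (i p + 1))
              (fun l => c p l + 2 ^ (i p - s) + 2 ^ (i p + 1))
          · rw [indicator_of_mem hz, indicator_of_mem (htm p hz), mul_assoc]
          · rw [indicator_of_notMem hz]
            exact zero_le
      _ = (32 ^ d) ^ (n + 1) * ∫⁻ z in R', (∑ p ∈ F, (Q p).indicator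
            (fun z => κ⁻¹ * ‖b z - ⨍ w in E p, b w‖ₑ) z) ^ (n + 1) :=
          lintegral_const_mul' _ _ (by finiteness)
      _ ≤ (32 ^ d) ^ (n + 1) * (C₀ * volume R') := by
          gcongr
          exact hb.lintegral_sum_gridCell_le F (j + 5) t (fun p => i p + 5) m E κ n hEm hEQ hdisj
            hκ0 hκt hvol (fun p => by rw [hEv]; exact pow_ne_zero _ (by simpa using hi0 p))
            _ _ _ fun p => (hEI p).trans ((hsub p).trans hRR')
      _ ≤ (32 ^ d) ^ (n + 1) * (C₀ * ((2 ^ d) ^ d * volume R)) := by gcongr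
      _ = _ := by ring
  have hbm : AEMeasurable b volume := hb.1.aestronglyMeasurable.aemeasurable
  simp only [ENNReal.tsum_eq_iSup_sum, ENNReal.iSup_pow_of_ne_zero (Nat.succ_ne_zero n)]
  rw [lintegral_iSup_directed]
  · exact iSup_le hfin
  · intro F
    refine AEMeasurable.restrict ?_
    refine (Finset.aemeasurable_fun_sum _ fun p _ => ?_).pow_const _
    exact ((hbm.sub_const _).enorm.const_mul _).indicator measurableSet_Icc
  · refine Monotone.directed_le fun F F' h z => ?_
    simp only
    gcongr

theorem volume_cone_le {n k : ℕ} {s : Set (EuclideanSpace ℝ (Fin (n + 1)))}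
    {θ₀ : EuclideanSpace ℝ (Fin (n + 1))} (hθ₀ : ‖θ₀‖ ≤ 1) {η : ℝ} (hη : 0 < η) (hη1 : η ≤ 1)
    (hs : ∀ θ ∈ s, ‖θ - θ₀‖ ≤ η) :
    volume {y : EuclideanSpace ℝ (Fin (n + 1)) | ‖y‖ < k ∧ ‖y‖⁻¹ • y ∈ s} ≤
      ENNReal.ofReal ((k + 1) ^ (n + 2)) *
        volume (ball (0 : EuclideanSpace ℝ (Fin (n + 1))) 1) * ENNReal.ofReal η ^ n := by
  have hcover : {y : EuclideanSpace ℝ (Fin (n + 1)) | ‖y‖ < k ∧ ‖y‖⁻¹ • y ∈ s} ⊆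
      ⋃ m ∈ Finset.range (⌊k / η⌋₊ + 1), closedBall ((m * η) • θ₀) ((k + 1) * η) := by
    rintro y ⟨hy, hys⟩
    set θ := ‖y‖⁻¹ • y with hθ
    have hyθ : y = ‖y‖ • θ := by
      rcases eq_or_ne y 0 with h | h
      · simp [h]
      · rw [hθ, smul_smul, mul_inv_cancel₀ (norm_ne_zero_iff.2 h), one_smul]
    have h1 := Nat.floor_le (a := ‖y‖ / η) (by positivity)
    have h2 := Nat.lt_floor_add_one (‖y‖ / η)
    rw [le_div_iff₀ hη] at h1
    rw [div_lt_iff₀ hη] at h2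
    refine mem_iUnion₂.2 ⟨⌊‖y‖ / η⌋₊, ?_, ?_⟩
    · rw [Finset.mem_range, Nat.lt_succ_iff]
      exact Nat.floor_le_floor (by gcongr)
    · rw [mem_closedBall, dist_eq_norm]
      have e : y - ((⌊‖y‖ / η⌋₊ : ℝ) * η) • θ₀ =
          ‖y‖ • (θ - θ₀) + (‖y‖ - (⌊‖y‖ / η⌋₊ : ℝ) * η) • θ₀ := by
        rw [smul_sub, sub_smul, ← hyθ, sub_add_sub_cancel]
      rw [e]
      refine (norm_add_le _ _).trans ?_
      rw [norm_smul, norm_smul, norm_norm, Real.norm_of_nonneg (by linarith)]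
      have h3 := hs _ hys
      have h4 : ‖y‖ * ‖θ - θ₀‖ ≤ k * η := by gcongr
      have h5 : (‖y‖ - (⌊‖y‖ / η⌋₊ : ℝ) * η) * ‖θ₀‖ ≤ η * 1 := by
        gcongr; linarith
      linarith
  have hM : ((⌊k / η⌋₊ + 1 : ℕ) : ℝ) ≤ (k + 1) / η := by
    push_cast
    have := Nat.floor_le (a := (k : ℝ) / η) (by positivity)
    have h1 : 1 ≤ 1 / η := by rw [le_div_iff₀ hη]; linarith
    rw [add_div]; linarith
  calc _ ≤ ∑ m ∈ Finset.range (⌊k / η⌋₊ + 1), volume (closedBall ((m * η) • θ₀) ((k + 1) * η)) :=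
        (measure_mono hcover).trans (measure_biUnion_finset_le _ _)
    _ = ENNReal.ofReal ((⌊k / η⌋₊ + 1 : ℕ) : ℝ) * (ENNReal.ofReal (((k + 1) * η) ^ (n + 1)) *
          volume (ball (0 : EuclideanSpace ℝ (Fin (n + 1))) 1)) := by
        simp only [Measure.addHaar_closedBall volume _ (show 0 ≤ (k + 1) * η by positivity),
          finrank_euclideanSpace, Fintype.card_fin, Finset.sum_const, Finset.card_range,
          nsmul_eq_mul, ENNReal.ofReal_natCast]
    _ ≤ ENNReal.ofReal ((k + 1) / η) * (ENNReal.ofReal (((k + 1) * η) ^ (n + 1)) *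
          volume (ball (0 : EuclideanSpace ℝ (Fin (n + 1))) 1)) := by gcongr
    _ = _ := by
        rw [← ENNReal.ofReal_pow hη.le, mul_right_comm, ← mul_assoc,
          ← ENNReal.ofReal_mul (by positivity), ← ENNReal.ofReal_mul (by positivity)]
        congr 2
        rw [mul_pow]
        field_simp
        ring

theorem ae_of_ae_hausdorffMeasure_sphere {n : ℕ} {N : Set (EuclideanSpace ℝ (Fin (n + 1)))} (hN : MeasurableSet N)
    (h0 : (μH[n] : Measure (EuclideanSpace ℝ (Fin (n + 1)))) (N ∩ sphere 0 1) = 0) :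
    volume {y : EuclideanSpace ℝ (Fin (n + 1)) | y ≠ 0 ∧ ‖y‖⁻¹ • y ∈ N} = 0 := by
  have hmeas : Measurable fun y : EuclideanSpace ℝ (Fin (n + 1)) => ‖y‖⁻¹ • y := by fun_prop
  suffices H : ∀ k : ℕ, volume {y : EuclideanSpace ℝ (Fin (n + 1)) |
      ‖y‖ < k ∧ ‖y‖⁻¹ • y ∈ N ∩ sphere 0 1} = 0 by
    refine measure_mono_null (fun y hy => ?_) (measure_iUnion_null H)
    obtain ⟨k, hk⟩ := exists_nat_gt ‖y‖
    refine mem_iUnion.2 ⟨k, hk, hy.2, ?_⟩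
    simp [norm_smul, hy.1]
  intro k
  set μ := (volume.restrict (ball (0 : EuclideanSpace ℝ (Fin (n + 1))) k)).map
    fun y => ‖y‖⁻¹ • y with hμ
  have hμs : ∀ s, MeasurableSet s → μ s =
      volume {y : EuclideanSpace ℝ (Fin (n + 1)) | ‖y‖ < k ∧ ‖y‖⁻¹ • y ∈ s} := fun s hs => by
    rw [hμ, Measure.map_apply hmeas hs, Measure.restrict_apply (hmeas hs)]
    congr 1
    ext y
    simp [and_comm]
  set C : ℝ≥0∞ := ENNReal.ofReal ((k + 1) ^ (n + 2)) *
        volume (ball (0 : EuclideanSpace ℝ (Fin (n + 1))) 1) with hC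
  have hC0 : C ≠ 0 := by
    refine mul_ne_zero ?_ (measure_ball_pos volume _ one_pos).ne'
    simp; positivity
  have hCt : C ≠ ⊤ := ENNReal.mul_ne_top (by simp) measure_ball_lt_top.ne
  have hle : C⁻¹ • μ ≤ μH[n] := by
    refine Measure.le_hausdorffMeasure n _ (ENNReal.ofReal (1 / 2)) (by simp) fun s hs => ?_
    rw [ENNReal.rpow_natCast, Measure.smul_apply, smul_eq_mul, ← ENNReal.div_eq_inv_mul]
    refine ENNReal.div_le_of_le_mul' ?_
    rw [← Metric.ediam_closure] at hs ⊢
    refine (measure_mono (subset_closure (s := s))).trans ?_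
    rw [hμs _ isClosed_closure.measurableSet]
    rcases eq_empty_or_nonempty {y : EuclideanSpace ℝ (Fin (n + 1)) |
      ‖y‖ < k ∧ ‖y‖⁻¹ • y ∈ closure s} with h | ⟨w, -, hw⟩
    · rw [h, measure_empty]; exact zero_le
    have ht : ediam (closure s) ≠ ⊤ := (hs.trans_lt ENNReal.ofReal_lt_top).ne
    set δ := (ediam (closure s)).toReal with hδ
    have hδe : ediam (closure s) = ENNReal.ofReal δ := (ENNReal.ofReal_toReal ht).symm
    have hδ1 : δ < 1 := by
      rw [hδe, ENNReal.ofReal_le_ofReal_iff (by norm_num)] at hs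
      linarith
    have hδ0 : 0 ≤ δ := ENNReal.toReal_nonneg
    have hlim : Tendsto (fun η : ℝ => C * ENNReal.ofReal η ^ n) (𝓝[>] δ)
        (𝓝 (C * ENNReal.ofReal δ ^ n)) := by
      refine (Continuous.tendsto ?_ δ).mono_left nhdsWithin_le_nhds
      exact (ENNReal.continuous_const_mul hCt).comp
        ((ENNReal.continuous_pow n).comp ENNReal.continuous_ofReal)
    rw [hδe]
    refine ge_of_tendsto hlim ?_
    filter_upwards [Ioo_mem_nhdsGT hδ1] with η hη
    refine volume_cone_le (θ₀ := ‖w‖⁻¹ • w) ?_ (hδ0.trans_lt hη.1) hη.2.le fun θ hθ => ?_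
    · rw [norm_smul, norm_inv, norm_norm]
      exact inv_mul_le_one
    · rw [← dist_eq_norm, ← ENNReal.ofReal_le_ofReal_iff (hδ0.trans hη.1.le), ← edist_dist]
      exact (Metric.edist_le_ediam_of_mem hθ hw).trans (hδe.le.trans (by gcongr; exact hη.1.le))
  have hN' := hN.inter (isClosed_sphere (x := (0 : EuclideanSpace ℝ (Fin (n + 1)))) (ε := 1)).measurableSet
  rw [← hμs _ hN']
  have := hle (N ∩ sphere 0 1)
  rw [h0, Measure.smul_apply, smul_eq_mul, nonpos_iff_eq_zero, mul_eq_zero] at this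
  exact this.resolve_left (by simpa using hCt)

theorem Gam_nonneg {d : ℕ} {ι : Type} [Fintype ι] {ζ : Rd d → ℝ} (hζ : ∀ x, 0 ≤ ζ x)
    (e : ι → Rd d) (a : ℝ) (ν : ι) (ξ : Rd d) : 0 ≤ Gam ζ e a ν ξ :=
  div_nonneg (hζ _) (Finset.sum_nonneg fun _ _ => hζ _)

theorem Gam_le_one {d : ℕ} {ι : Type} [Fintype ι] {ζ : Rd d → ℝ} (hζ : ∀ x, 0 ≤ ζ x)
    (e : ι → Rd d) (a : ℝ) (ν : ι) (ξ : Rd d) : Gam ζ e a ν ξ ≤ 1 :=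
  div_le_one_of_le₀
    (Finset.single_le_sum (f := fun ν' => ζ ((2:ℝ) ^ a • (‖ξ‖⁻¹ • ξ - e ν'))) (fun _ _ => hζ _)
      (Finset.mem_univ ν))
    (Finset.sum_nonneg fun _ _ => hζ _)

theorem PhiCutoff.le_one {d : ℕ} {φ : Rd d → ℝ} (hφ : PhiCutoff φ) (x : Rd d) : φ x ≤ 1 := by
  obtain ⟨-, h0, -, hs, h1⟩ := hφ
  rcases eq_or_ne x 0 with rfl | hx
  · have : (0 : Rd d) ∉ Function.support φ := fun h => by
      have := (hs h).1
      norm_num at this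
    rw [Function.notMem_support.1 this]
    exact zero_le_one
  · simpa using le_hasSum (h1 x hx) 0 fun j _ => h0 _

theorem PhiCutoff.norm_mem_of_ne_zero {d : ℕ} {φ : Rd d → ℝ} (hφ : PhiCutoff φ) {i : ℤ} {w : Rd d}
    (h : φ ((2:ℝ) ^ (-i) • w) ≠ 0) : (2:ℝ) ^ (i - 1) ≤ ‖w‖ ∧ ‖w‖ ≤ 2 ^ (i + 1) := by
  obtain ⟨h1, h2⟩ := hφ.2.2.2.1 h
  have hi : (0:ℝ) < 2 ^ i := by positivity
  rw [norm_smul, Real.norm_of_nonneg (by positivity), zpow_neg, inv_mul_eq_div] at h1 h2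
  rw [le_div_iff₀ hi] at h1
  rw [div_le_iff₀ hi] at h2
  rw [zpow_sub₀ (by norm_num), zpow_add₀ (by norm_num), zpow_one]
  constructor <;> linarith

theorem abs_Kjnu_le {d : ℕ} {ι : Type} [Fintype ι] {Ω φ ζ : Rd d → ℝ} (hφ : PhiCutoff φ)
    (hζ : ∀ x, 0 ≤ ζ x) (e : ι → Rd d) (a : ℝ) (i : ℤ) (ν : ι) {w : Rd d}
    (hw : |Ω (‖w‖⁻¹ • w)| ≤ 1) : |Kjnu Ω φ ζ e a i ν w| ≤ (((2:ℝ) ^ (i - 1)) ^ d)⁻¹ := by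
  by_cases h : φ ((2:ℝ) ^ (-i) • w) = 0
  · rw [Kjnu, h, mul_zero, zero_mul, abs_zero]
    positivity
  have h1 := (hφ.norm_mem_of_ne_zero h).1
  have hw0 : 0 < ‖w‖ := lt_of_lt_of_le (by positivity) h1
  rw [Kjnu, abs_mul, abs_mul, abs_div, abs_of_nonneg (hφ.2.1 _),
    abs_of_nonneg (Gam_nonneg hζ e a ν _), abs_of_nonneg (by positivity : 0 ≤ ‖w‖ ^ d)]
  calc _ ≤ 1 / ((2:ℝ) ^ (i - 1)) ^ d * 1 * 1 := by
        gcongr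
        · exact Gam_nonneg hζ e a ν _
        · exact hφ.2.1 _
        · exact hφ.le_one _
        · exact Gam_le_one hζ e a ν _
    _ = _ := by simp

theorem Kjnu_eq_zero {d : ℕ} {ι : Type} [Fintype ι] {Ω φ ζ : Rd d → ℝ} (hφ : PhiCutoff φ)
    (e : ι → Rd d) (a : ℝ) (i : ℤ) (ν : ι) {w : Rd d} (hw : 2 ^ (i + 1) < ‖w‖) :
    Kjnu Ω φ ζ e a i ν w = 0 := by
  have h : φ ((2:ℝ) ^ (-i) • w) = 0 := by
    by_contra h
    exact hw.not_ge (hφ.norm_mem_of_ne_zero h).2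
  rw [Kjnu, h, mul_zero, zero_mul]

theorem abs_convK_le {d : ℕ} {K g : Rd d → ℝ} {A : ℝ} (hK : ∀ᵐ w, |K w| ≤ A)
    (hg : Integrable g volume) (z : Rd d) : |convK K g z| ≤ A * ∫ y, |g y| := by
  rw [convK, ← integral_const_mul, ← Real.norm_eq_abs]
  refine norm_integral_le_of_norm_le (hg.abs.const_mul A) ?_
  filter_upwards [(quasiMeasurePreserving_sub_left volume z).ae hK] with y hy
  rw [norm_mul, Real.norm_eq_abs, Real.norm_eq_abs]
  gcongr

theorem setOf_forall_mem_Icc_eq_preimage {d : ℕ} (u v : Fin d → ℝ) :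
    {z : Rd d | ∀ l, z l ∈ Icc (u l) (v l)} = WithLp.ofLp ⁻¹' Icc u v := by
  ext z
  simp [Pi.le_def, forall_and]

theorem volume_setOf_forall_mem_Icc {d : ℕ} (u v : Fin d → ℝ) :
    volume {z : Rd d | ∀ l, z l ∈ Icc (u l) (v l)} = volume (Icc u v) := by
  rw [setOf_forall_mem_Icc_eq_preimage]
  exact (PiLp.volume_preserving_ofLp (Fin d)).measure_preimage measurableSet_Icc.nullMeasurableSet

theorem ae_abs_Kjnu_le {d : ℕ} (hd : 0 < d) {ι : Type} [Fintype ι] {Ω φ ζ : Rd d → ℝ}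
    (hΩ : Measurable Ω) (hΩ1 : ∀ᵐ θ ∂(sphereMeasure d), |Ω θ| ≤ 1) (hφ : PhiCutoff φ)
    (hζ : ∀ x, 0 ≤ ζ x) (e : ι → Rd d) (a : ℝ) (i : ℤ) (ν : ι) :
    ∀ᵐ w, |Kjnu Ω φ ζ e a i ν w| ≤ (((2:ℝ) ^ (i - 1)) ^ d)⁻¹ := by
  obtain ⟨n, rfl⟩ := Nat.exists_eq_add_of_le' hd
  have hN : MeasurableSet {θ | ¬ |Ω θ| ≤ 1} :=
    (measurableSet_le hΩ.abs measurable_const).compl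
  have h0 : (μH[n] : Measure (Rd (n + 1))) ({θ | ¬ |Ω θ| ≤ 1} ∩ sphere 0 1) = 0 := by
    rw [ae_iff, sphereMeasure, Measure.restrict_apply hN] at hΩ1
    simpa using hΩ1
  refine measure_mono_null (fun w hw => ?_) (ae_of_ae_hausdorffMeasure_sphere hN h0)
  refine ⟨?_, fun h => hw (abs_Kjnu_le hφ hζ e a i ν h)⟩
  rintro rfl
  refine hw ?_
  by_cases h : φ ((2:ℝ) ^ (-i) • (0 : Rd (n + 1))) = 0
  · simp only [mem_ofPred_eq, Kjnu, h, mul_zero, zero_mul, abs_zero]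
    positivity
  · have := (hφ.norm_mem_of_ne_zero h).1
    rw [norm_zero] at this
    exact absurd this (not_le.2 (by positivity))

theorem enorm_convK_Kjnu_le {d : ℕ} (hd : 0 < d) {ι : Type} [Fintype ι] {Ω φ ζ : Rd d → ℝ}
    (hΩ : Measurable Ω) (hΩ1 : ∀ᵐ θ ∂(sphereMeasure d), |Ω θ| ≤ 1) (hφ : PhiCutoff φ)
    (hζ : ∀ x, 0 ≤ ζ x) (e : ι → Rd d) (a : ℝ) (i : ℤ) (s : ℕ) (ν : ι) {c : Fin d → ℝ}
    {g : Rd d → ℝ} (hg : Integrable g volume)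
    (hgs : Function.support g ⊆ {z | ∀ l, z l ∈ Icc (c l) (c l + (2:ℝ) ^ (i - s))})
    (hg1 : ∫⁻ y, ENNReal.ofReal |g y| ≤
      volume {z : Rd d | ∀ l, z l ∈ Icc (c l) (c l + (2:ℝ) ^ (i - s))}) (z : Rd d) :
    ‖convK (Kjnu Ω φ ζ e a i ν) g z‖ₑ ≤
      (Icc (fun l => c l - 2 ^ (i + 1)) (fun l => c l + 2 ^ (i - s) + 2 ^ (i + 1))).indicator
        (fun _ => 2 ^ d * ((2 ^ s) ^ d)⁻¹) z.ofLp := by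
  have hi0 : (0:ℝ) < 2 ^ (i - s) := by positivity
  by_cases hz : z.ofLp ∈ Icc (fun l => c l - 2 ^ (i + 1)) (fun l => c l + 2 ^ (i - s) + 2 ^ (i + 1))
  · rw [indicator_of_mem hz]
    have hg_int : ∫ y, |g y| ≤ ((2:ℝ) ^ (i - s)) ^ d := by
      rw [integral_eq_lintegral_of_nonneg_ae (Eventually.of_forall fun _ => abs_nonneg _)
        hg.abs.aestronglyMeasurable]
      refine ENNReal.toReal_le_of_le_ofReal (by positivity) (hg1.trans (le_of_eq ?_))
      rw [volume_setOf_forall_mem_Icc c fun l => c l + (2:ℝ) ^ (i - s), Real.volume_Icc_pi]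
      simp [ENNReal.ofReal_pow hi0.le]
    have h1 := (abs_convK_le (ae_abs_Kjnu_le hd hΩ hΩ1 hφ hζ e a i ν) hg z).trans
      (mul_le_mul_of_nonneg_left hg_int (by positivity))
    have h2 : (((2:ℝ) ^ (i - 1)) ^ d)⁻¹ * ((2:ℝ) ^ (i - s)) ^ d = 2 ^ d * ((2 ^ s) ^ d)⁻¹ := by
      rw [← inv_pow, ← inv_pow, ← mul_pow, ← mul_pow, zpow_sub₀ (by norm_num),
        zpow_sub₀ (by norm_num), zpow_one, zpow_natCast]
      congr 1
      field_simp
    rw [h2] at h1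
    rw [← ofReal_norm, Real.norm_eq_abs]
    refine (ENNReal.ofReal_le_ofReal h1).trans (le_of_eq ?_)
    rw [ENNReal.ofReal_mul (by positivity), ENNReal.ofReal_inv_of_pos (by positivity),
      ENNReal.ofReal_pow (by norm_num), ENNReal.ofReal_pow (by positivity),
      ENNReal.ofReal_pow (by norm_num), ENNReal.ofReal_ofNat]
  · rw [indicator_of_notMem hz, nonpos_iff_eq_zero, enorm_eq_zero, convK]
    refine integral_eq_zero_of_ae (Eventually.of_forall fun y => ?_)
    by_cases hy : g y = 0
    · simp [hy]
    have hyI := hgs hy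
    have hfar : (2:ℝ) ^ (i + 1) < ‖z - y‖ := by
      have : ∃ l, (2:ℝ) ^ (i + 1) < |z l - y l| := by
        by_contra! h
        refine hz ⟨fun l => ?_, fun l => ?_⟩
        · have h1 := abs_le.1 (h l)
          have h2 := hyI l
          simp only [mem_Icc] at h2 ⊢
          linarith
        · have h1 := abs_le.1 (h l)
          have h2 := hyI l
          simp only [mem_Icc] at h2 ⊢
          linarith
      obtain ⟨l, hl⟩ := this
      exact hl.trans_le (PiLp.norm_apply_le (z - y) l)
    simp [Kjnu_eq_zero hφ e a i ν hfar]

theorem measurableEmbedding_toLp (d : ℕ) :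
    MeasurableEmbedding (WithLp.toLp 2 : (Fin d → ℝ) → Rd d) :=
  (MeasurableEquiv.toLp 2 (Fin d → ℝ)).measurableEmbedding

theorem setAverage_Icc_comp_toLp {d : ℕ} (g : Rd d → ℝ) (u v : Fin d → ℝ) :
    (⨍ z in Icc u v, g (WithLp.toLp 2 z)) = ⨍ z in {z : Rd d | ∀ l, z l ∈ Icc (u l) (v l)}, g z := by
  rw [setAverage_eq, setAverage_eq, Measure.real, Measure.real, volume_setOf_forall_mem_Icc,
    setOf_forall_mem_Icc_eq_preimage]
  congr 1
  exact (PiLp.volume_preserving_toLp (Fin d)).setIntegral_preimage_emb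
    (measurableEmbedding_toLp d) g (WithLp.ofLp ⁻¹' Icc u v)

theorem BMOBound.piBMO {d : ℕ} {b : Rd d → ℝ} (hb : BMOBound b 1) :
    PiBMO fun z => b (WithLp.toLp 2 z) := by
  refine ⟨locallyIntegrable_iff.2 fun K hK => ?_, fun a l hl => ?_⟩
  · have hK' : IsCompact (WithLp.ofLp ⁻¹' K : Set (Rd d)) :=
      (PiLp.homeomorph 2 fun _ : Fin d => ℝ).isCompact_preimage.2 hK
    exact ((PiLp.volume_preserving_toLp (Fin d)).integrableOn_comp_preimage
      (measurableEmbedding_toLp d)).2 (hb.1.integrableOn_isCompact hK')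
  · rw [setAverage_Icc_comp_toLp b, setAverage_Icc_comp_toLp fun z => |b z - _|]
    exact hb.2 _ ⟨l, hl, WithLp.toLp 2 a, rfl⟩

theorem IsCubeSide.side_unique {d : ℕ} (hd : 0 < d) {Q : Set (Rd d)} {l l' : ℝ} (hl : 0 ≤ l)
    (hl' : 0 ≤ l') (h : IsCubeSide Q l) (h' : IsCubeSide Q l') : l = l' := by
  have key : ∀ r : ℝ, 0 ≤ r → IsCubeSide Q r → (volume Q).toReal = r ^ d := by
    rintro r hr ⟨c, rfl⟩
    rw [volume_setOf_forall_mem_Icc c fun i => c i + r, Real.volume_Icc_pi]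
    simp [hr]
  rw [← pow_left_inj₀ hl hl' hd.ne', ← key l hl h, key l' hl' h']

theorem norm_le_of_mem_RR {d : ℕ} {e : Rd d} (he : ‖e‖ = 1) {j : ℤ} {a : ℝ} (ha : 0 ≤ a) {y : Rd d}
    (hy : y ∈ RR e j a) : ‖y‖ ≤ 2 ^ (j + 4) := by
  have key : ∀ u ∈ Rtil e j a, ‖u‖ ≤ 2 ^ (j + 3) := by
    rintro u ⟨h1, h2⟩
    have h3 : (2:ℝ) ^ (-a) ≤ 1 := Real.rpow_le_one_of_one_le_of_nonpos (by norm_num) (by linarith)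
    have h4 : (2:ℝ) ^ (j + 2) * (2:ℝ) ^ (-a) ≤ 2 ^ (j + 2) :=
      mul_le_of_le_one_right (by positivity) h3
    calc ‖u‖ = ‖⟪u, e⟫ • e + (u - ⟪u, e⟫ • e)‖ := by rw [add_sub_cancel]
      _ ≤ ‖⟪u, e⟫ • e‖ + ‖u - ⟪u, e⟫ • e‖ := norm_add_le _ _
      _ ≤ 2 ^ (j + 2) + 2 ^ (j + 2) := by
          gcongr
          · rwa [norm_smul, he, mul_one, Real.norm_eq_abs]
          · exact h2.trans h4
      _ = 2 ^ (j + 3) := by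
          rw [show j + 3 = j + 2 + 1 by ring, zpow_add₀ (by norm_num) (j + 2), zpow_one]; ring
  obtain ⟨u, hu, v, hv, rfl⟩ := hy
  calc ‖u + v‖ ≤ ‖u‖ + ‖v‖ := norm_add_le _ _
    _ ≤ 2 ^ (j + 3) + 2 ^ (j + 3) := add_le_add (key u hu) (key v hv)
    _ = 2 ^ (j + 4) := by
        rw [show j + 4 = j + 3 + 1 by ring, zpow_add₀ (by norm_num) (j + 3), zpow_one]; ring

theorem rpow_mul_log_rpow_le {p : ℝ} (hp : 1 < p) {q : ℕ} (hpq : p ≤ q) {u : ℝ} (hu : 0 ≤ u) :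
    u ^ p * Real.log (Real.exp 1 + u) ^ (-p) ≤ 2⁻¹ + (2 * u) ^ q := by
  have hlog : Real.log (Real.exp 1 + u) ^ (-p) ≤ 1 := by
    refine Real.rpow_le_one_of_one_le_of_nonpos ?_ (by linarith)
    rw [Real.le_log_iff_exp_le (by positivity)]
    linarith
  refine (mul_le_of_le_one_right (by positivity) hlog).trans ?_
  rcases le_total u 2⁻¹ with h | h
  · have h1 : u ^ p ≤ u := by
      simpa using Real.rpow_le_rpow_of_exponent_ge' hu (by linarith) zero_le_one hp.le
    have : 0 ≤ (2 * u) ^ q := by positivity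
    linarith
  · have h1 : 1 ≤ 2 * u := by linarith
    calc u ^ p ≤ (2 * u) ^ p := by gcongr; linarith
      _ ≤ (2 * u) ^ (q : ℝ) := Real.rpow_le_rpow_of_exponent_le h1 hpq
      _ = (2 * u) ^ q := Real.rpow_natCast _ _
      _ ≤ _ := by linarith

theorem luxNorm_le_ofReal {d : ℕ} {p : ℝ} (hp : 1 < p) {q : ℕ} (hpq : p ≤ q) {R : Set (Rd d)}
    {f : Rd d → ℝ} {A : ℝ≥0∞} {t : ℝ} (ht : 0 < t)
    (hf : ∫⁻ z in R, ‖f z‖ₑ ^ q ≤ A * volume R) (hA : 2 ^ (q + 1) * A ≤ ENNReal.ofReal t ^ q) :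
    LuxNorm p (-p) R f ≤ ENNReal.ofReal t := by
  refine sInf_le ⟨t, ht, rfl, ?_⟩
  have ht0 : ENNReal.ofReal t ≠ 0 := by simpa using ht
  have hpt : ∀ z, ENNReal.ofReal
      ((|f z| / t) ^ p * Real.log (Real.exp 1 + |f z| / t) ^ (-p)) ≤
      2⁻¹ + 2 ^ q * (ENNReal.ofReal t ^ q)⁻¹ * ‖f z‖ₑ ^ q := fun z => by
    refine (ENNReal.ofReal_le_ofReal
      (rpow_mul_log_rpow_le hp hpq (by positivity : 0 ≤ |f z| / t))).trans (le_of_eq ?_)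
    rw [ENNReal.ofReal_add (by norm_num) (by positivity), ENNReal.ofReal_inv_of_pos (by norm_num),
      ENNReal.ofReal_ofNat, ENNReal.ofReal_pow (by positivity), ENNReal.ofReal_mul (by norm_num),
      ENNReal.ofReal_div_of_pos ht, ENNReal.ofReal_ofNat, ← Real.norm_eq_abs, ofReal_norm,
      mul_pow, div_eq_mul_inv, mul_pow, ENNReal.inv_pow]
    ring
  have hkey : 2 ^ q * (ENNReal.ofReal t ^ q)⁻¹ * A ≤ 2⁻¹ := by
    rw [ENNReal.le_inv_iff_mul_le]
    calc 2 ^ q * (ENNReal.ofReal t ^ q)⁻¹ * A * 2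
        = (ENNReal.ofReal t ^ q)⁻¹ * (2 ^ (q + 1) * A) := by ring
      _ ≤ (ENNReal.ofReal t ^ q)⁻¹ * ENNReal.ofReal t ^ q := by gcongr
      _ ≤ 1 := ENNReal.inv_mul_le_one _
  calc _ ≤ ∫⁻ z in R, (2⁻¹ + 2 ^ q * (ENNReal.ofReal t ^ q)⁻¹ * ‖f z‖ₑ ^ q) := lintegral_mono hpt
    _ = 2⁻¹ * volume R + 2 ^ q * (ENNReal.ofReal t ^ q)⁻¹ * ∫⁻ z in R, ‖f z‖ₑ ^ q := by
        rw [lintegral_add_left measurable_const, setLIntegral_const, lintegral_const_mul']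
        have := ENNReal.inv_ne_top.2 (pow_ne_zero q ht0)
        finiteness
    _ ≤ 2⁻¹ * volume R + 2 ^ q * (ENNReal.ofReal t ^ q)⁻¹ * (A * volume R) := by gcongr
    _ ≤ 2⁻¹ * volume R + 2⁻¹ * volume R := by
        refine add_le_add_right ?_ _
        rw [← mul_assoc]
        exact mul_le_mul_left hkey _
    _ = volume R := by rw [← add_mul, ENNReal.inv_two_add_inv_two, one_mul]

theorem GoodFamily.countable {d : ℕ} {S : Set (Set (Rd d))} {h : Set (Rd d) → Rd d → ℝ}
    (hS : GoodFamily S h) : S.Countable := by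
  refine (countable_range fun q : ℤ × (Fin d → ℤ) =>
    {x : Rd d | ∀ i, x i ∈ Icc ((2:ℝ) ^ q.1 * q.2 i) ((2:ℝ) ^ q.1 * (q.2 i + 1))}).mono ?_
  intro Q hQ
  obtain ⟨k, m, rfl⟩ := hS.1 Q hQ
  exact ⟨(k, m), rfl⟩

theorem disjoint_openBox_of_interior_inter_eq_empty {d : ℕ} {u v u' v' : Fin d → ℝ}
    (h : interior {z : Rd d | ∀ l, z l ∈ Icc (u l) (v l)} ∩
      interior {z : Rd d | ∀ l, z l ∈ Icc (u' l) (v' l)} = ∅) :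
    Disjoint (univ.pi fun l => Ioo (u l) (v l)) (univ.pi fun l => Ioo (u' l) (v' l)) := by
  have key : ∀ u v : Fin d → ℝ, WithLp.ofLp ⁻¹' (univ.pi fun l => Ioo (u l) (v l)) ⊆
      interior {z : Rd d | ∀ l, z l ∈ Icc (u l) (v l)} := fun u v =>
    interior_maximal (fun z hz l => Ioo_subset_Icc_self (hz l trivial))
      ((isOpen_set_pi finite_univ fun l _ => isOpen_Ioo).preimage (PiLp.continuous_ofLp 2 _))
  refine Set.disjoint_left.2 fun z hz hz' => ?_
  exact (h.le ⟨key u v (a := WithLp.toLp 2 z) hz, key u' v' (a := WithLp.toLp 2 z) hz'⟩ :)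

/-- inequality (3.6) in Section 4.
`‖Σ_{i≤j} Σ_{I∈S_{i-s}, I∩(x+R_{jν}^s)≠∅} |(b-⟨b⟩_I)T_{iν}^s h_I|‖_{L^p(log L)^{-p}, R}
  ≤ C_{d,γ,p}·s`, where `R` is the cube centered at `x` of side length `2^{j+5}d`. -/
theorem statement11 (d : ℕ) (hd : 2 ≤ d) (γ : ℝ) (hγ0 : 0 < γ) (hγ1 : γ < 1)
    (p : ℝ) (hp : 1 < p)
    (ζ φ : Rd d → ℝ) (hζ : ZetaCutoff ζ) (hφ : PhiCutoff φ) :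
    ∃ C : ℝ, 0 < C ∧
      ∀ (s : ℕ), 100 ≤ s →
      ∀ (ι : Type) [Fintype ι], ∀ (e : ι → Rd d), SphereNet e s γ →
      ∀ (Ω : Rd d → ℝ), Measurable Ω → Homog0 Ω →
        (∀ᵐ θ ∂(sphereMeasure d), |Ω θ| ≤ 1) →
      ∀ (b : Rd d → ℝ), BMOBound b 1 →
      ∀ (S : Set (Set (Rd d))) (h : Set (Rd d) → Rd d → ℝ), GoodFamily S h →
      ∀ (j : ℤ) (ν : ι) (x : Rd d),
        LuxNorm p (-p)
            {z : Rd d | ∀ i, z i ∈ Icc (x i - (2:ℝ) ^ (j + 4) * d) (x i + (2:ℝ) ^ (j + 4) * d)}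
            (fun z => ∑' (i : {i : ℤ // i ≤ j}),
              ∑' (I : {I : Set (Rd d) // I ∈ S ∧ IsCubeSide I ((2:ℝ) ^ ((i:ℤ) - (s:ℤ))) ∧
                  (I ∩ {y | y - x ∈ RR (e ν) j ((s:ℝ) * γ)}).Nonempty}),
                |(b z - cavg b I.1) *
                  convK (Kjnu Ω φ ζ e ((s:ℝ) * γ) (i:ℤ) ν) (h I.1) z|) ≤
          ENNReal.ofReal (C * s) := by

  have hd0 : 0 < d := by omega
  obtain ⟨n, hn⟩ : ∃ n : ℕ, p ≤ ((n + 1 : ℕ) : ℝ) := by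
    obtain ⟨n, hn⟩ := exists_nat_ge p
    exact ⟨n, hn.trans (by push_cast; linarith)⟩
  obtain ⟨C, hCt, hC⟩ := PiBMO.lintegral_tsum_pow_le hd0 n
  set A : ℝ≥0∞ := (2 ^ d) ^ (n + 1) * C with hA
  have hAt : 2 ^ (n + 1 + 1) * A ≠ ⊤ := by finiteness
  set t := (2 ^ (n + 1 + 1) * A).toReal + 1 with ht
  have ht1 : 1 ≤ t := by simp [ht]
  refine ⟨t, by linarith, ?_⟩
  intro s hs ι _ e he Ω hΩ _ hΩ1 b hb S h hS j ν x
  have hs1 : (1:ℝ) ≤ s := by exact_mod_cast (show 1 ≤ s by omega)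
  refine luxNorm_le_ofReal (A := A) hp hn (by positivity) ?_ ?_
  swap
  · calc 2 ^ (n + 1 + 1) * A = ENNReal.ofReal (2 ^ (n + 1 + 1) * A).toReal :=
          (ENNReal.ofReal_toReal hAt).symm
      _ ≤ ENNReal.ofReal (t * s) :=
          ENNReal.ofReal_le_ofReal ((by linarith : _ ≤ t).trans (le_mul_of_one_le_right (by linarith) hs1))
      _ ≤ ENNReal.ofReal (t * s) ^ (n + 1) := by
          refine le_self_pow₀ ?_ n.succ_ne_zero
          rw [ENNReal.one_le_ofReal]
          nlinarith
  let I : ℤ → Type := fun i => {I : Set (Rd d) // I ∈ S ∧ IsCubeSide I ((2:ℝ) ^ (i - (s:ℤ))) ∧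
    (I ∩ {y | y - x ∈ RR (e ν) j ((s:ℝ) * γ)}).Nonempty}
  let J : Type := Σ i : {i : ℤ // i ≤ j}, I i
  have : ∀ i, Countable (I i) := fun i =>
    (hS.countable.mono fun Q (hQ : Q ∈ {I : Set (Rd d) | I ∈ S ∧ _}) => hQ.1).to_subtype
  have : Countable J := inferInstanceAs (Countable (Σ i : {i : ℤ // i ≤ j}, I i))
  choose c hc using fun q : J => q.2.2.2.1
  have hsub : ∀ q : J, Icc (c q).ofLp (fun l => c q l + 2 ^ ((q.1 : ℤ) - s)) ⊆
      Icc (fun l => x l - 2 ^ (j + 4) * d) (fun l => x l + 2 ^ (j + 4) * d) := by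
    intro q w hw
    obtain ⟨y, hyI, hy⟩ := q.2.2.2.2
    rw [hc q] at hyI
    have hyx := norm_le_of_mem_RR (he.1 ν) (by positivity) hy
    have hside : (2:ℝ) ^ ((q.1 : ℤ) - s) ≤ 2 ^ (j + 4) :=
      zpow_le_zpow_right₀ (by norm_num) (by have := q.1.2; omega)
    have hd2 : (2:ℝ) ^ (j + 4) * 2 ≤ 2 ^ (j + 4) * d := by
      gcongr; exact_mod_cast hd
    have hl : ∀ l, x l - 2 ^ (j + 4) * d ≤ w l ∧ w l ≤ x l + 2 ^ (j + 4) * d := fun l => by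
      have h1 := abs_le.1 ((PiLp.norm_apply_le (y - x) l).trans hyx)
      have h2 := hyI l
      have h3 := hw.1 l
      have h4 := hw.2 l
      simp only [PiLp.sub_apply, mem_Icc] at h1 h2 h3 h4
      constructor <;> linarith
    exact ⟨fun l => (hl l).1, fun l => (hl l).2⟩
  have hdisj : Pairwise (Function.onFun Disjoint fun q : J =>
      univ.pi fun l => Ioo (c q l) (c q l + 2 ^ ((q.1 : ℤ) - s))) := by
    intro q q' hne
    refine disjoint_openBox_of_interior_inter_eq_empty ?_
    rw [← hc q, ← hc q']
    refine hS.2.1 q.2.2.1 q'.2.2.1 fun heq => hne ?_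
    have hi := IsCubeSide.side_unique hd0 (by positivity) (by positivity) q.2.2.2.1
      (heq ▸ q'.2.2.2.1)
    have hi' := zpow_right_injective₀ (by norm_num) (by norm_num) hi
    obtain ⟨⟨i, hij⟩, Q, hQ⟩ := q
    obtain ⟨⟨i', hij'⟩, Q', hQ'⟩ := q'
    obtain rfl : i = i' := by simpa using hi'
    obtain rfl : Q = Q' := heq
    rfl
  have hbound := hC _ hb.piBMO s j x.ofLp J (fun q => (c q).ofLp) (fun q => q.1) (fun q => q.1.2)
    hdisj hsub
  set R := {z : Rd d | ∀ i, z i ∈ Icc (x i - (2:ℝ) ^ (j + 4) * d) (x i + (2:ℝ) ^ (j + 4) * d)}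
  have hRv : volume R = volume (Icc (fun l => x l - (2:ℝ) ^ (j + 4) * d)
      fun l => x l + 2 ^ (j + 4) * d) :=
    volume_setOf_forall_mem_Icc _ _
  have hRp : R = WithLp.ofLp ⁻¹' Icc (fun l => x l - (2:ℝ) ^ (j + 4) * d)
      fun l => x l + 2 ^ (j + 4) * d := setOf_forall_mem_Icc_eq_preimage _ _
  set Φ : (Fin d → ℝ) → ℝ≥0∞ := fun z => ∑' q : J, (Icc (fun l => c q l - 2 ^ ((q.1 : ℤ) + 1))
      (fun l => c q l + 2 ^ ((q.1 : ℤ) - s) + 2 ^ ((q.1 : ℤ) + 1))).indicator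
    (fun z => ((2 ^ s) ^ d)⁻¹ * ‖b (WithLp.toLp 2 z) -
      ⨍ w in Icc (c q).ofLp (fun l => c q l + 2 ^ ((q.1 : ℤ) - s)), b (WithLp.toLp 2 w)‖ₑ) z
    with hΦ
  have hpt : ∀ z : Rd d, ‖∑' i : {i : ℤ // i ≤ j}, ∑' Q : I i, |(b z - cavg b Q.1) *
      convK (Kjnu Ω φ ζ e ((s:ℝ) * γ) i ν) (h Q.1) z|‖ₑ ≤ 2 ^ d * Φ z.ofLp := by
    intro z
    calc _ ≤ ∑' i : {i : ℤ // i ≤ j}, ∑' Q : I i, ‖|(b z - cavg b Q.1) *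
          convK (Kjnu Ω φ ζ e ((s:ℝ) * γ) i ν) (h Q.1) z|‖ₑ :=
          enorm_tsum_le_tsum_enorm.trans (ENNReal.tsum_le_tsum fun i => enorm_tsum_le_tsum_enorm)
      _ = ∑' q : J, ‖(b z - cavg b q.2.1) *
          convK (Kjnu Ω φ ζ e ((s:ℝ) * γ) q.1 ν) (h q.2.1) z‖ₑ := by
          simp only [Real.enorm_abs]
          exact (ENNReal.tsum_sigma' fun q : J => ‖(b z - cavg b q.2.1) *
            convK (Kjnu Ω φ ζ e ((s:ℝ) * γ) q.1 ν) (h q.2.1) z‖ₑ).symm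
      _ ≤ ∑' q : J, 2 ^ d * (Icc (fun l => c q l - 2 ^ ((q.1 : ℤ) + 1))
            (fun l => c q l + 2 ^ ((q.1 : ℤ) - s) + 2 ^ ((q.1 : ℤ) + 1))).indicator
          (fun z => ((2 ^ s) ^ d)⁻¹ * ‖b (WithLp.toLp 2 z) -
            ⨍ w in Icc (c q).ofLp (fun l => c q l + 2 ^ ((q.1 : ℤ) - s)), b (WithLp.toLp 2 w)‖ₑ)
          z.ofLp := by
          refine ENNReal.tsum_le_tsum fun q => ?_
          obtain ⟨hg, hgs, hg1⟩ := hS.2.2 q.2.1 q.2.2.1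
          have hconv := enorm_convK_Kjnu_le (c := (c q).ofLp) hd0 hΩ hΩ1 hφ hζ.2.1 e ((s:ℝ) * γ)
            q.1 s ν hg (hgs.trans (hc q).le) (hg1.trans (measure_mono (hc q).le)) z
          rw [enorm_mul]
          refine (mul_le_mul_right hconv _).trans (le_of_eq ?_)
          have havg : cavg b q.2.1 = ⨍ w in Icc (c q).ofLp
              (fun l => c q l + 2 ^ ((q.1 : ℤ) - s)), b (WithLp.toLp 2 w) := by
            rw [setAverage_Icc_comp_toLp b, cavg]
            exact congrArg (fun Q : Set (Rd d) => ⨍ x in Q, b x) (hc q)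
          rw [havg]
          by_cases hz : z.ofLp ∈ Icc (fun l => c q l - 2 ^ ((q.1 : ℤ) + 1))
            (fun l => c q l + 2 ^ ((q.1 : ℤ) - s) + 2 ^ ((q.1 : ℤ) + 1))
          · simp only [indicator_of_mem hz, WithLp.toLp_ofLp]
            ring
          · simp only [indicator_of_notMem hz, mul_zero]
      _ = _ := ENNReal.tsum_mul_left
  calc _ ≤ ∫⁻ z in R, (2 ^ d) ^ (n + 1) * Φ z.ofLp ^ (n + 1) := by
        refine lintegral_mono fun z => ?_
        rw [← mul_pow]
        exact pow_le_pow_left' (hpt z) _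
    _ = (2 ^ d) ^ (n + 1) * ∫⁻ z in R, Φ z.ofLp ^ (n + 1) :=
        lintegral_const_mul' _ _ (by finiteness)
    _ = (2 ^ d) ^ (n + 1) * ∫⁻ z in Icc (fun l => x l - (2:ℝ) ^ (j + 4) * d)
          (fun l => x l + 2 ^ (j + 4) * d), Φ z ^ (n + 1) := by
        rw [hRp]
        congr 1
        exact ((PiLp.volume_preserving_toLp (Fin d)).setLIntegral_comp_preimage_emb
          (measurableEmbedding_toLp d) (fun z => Φ z.ofLp ^ (n + 1)) _).symm
    _ ≤ (2 ^ d) ^ (n + 1) * (C * volume R) := by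
        rw [hRv]
        exact mul_le_mul_right hbound _
    _ = A * volume R := (mul_assoc _ _ _).symm
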